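/- arXiv:2104.03246 — 2 statements merged into one kernel-verified Lean document; each statement's English description precedes it below -/
import Mathlib

section
/- Let s₀ > 1/2 and s ≥ s₀. There is a constant C > 0 (depending on s, s₀ and the chosen dyadic partition) such that for all smooth divergence-free vector fields u, w : 𝕋² → ℝ², Σ_{k≥−1} 2^{2ks} |⟨Δ^v_k(u·∇w), Δ^v_k w⟩_{L²}| ≤ C ‖w‖_{H^{1/4,s}} ( ‖u‖_{H^{1/4,s₀}} ‖∂₁w‖_{H^{0,s}} + ‖u‖_{H^{1/4,s}} ‖∂₁w‖_{H^{0,s₀}} + ‖∂₁u‖_{H^{0,s₀}} ‖w‖_{H^{1/4,s}} + ‖∂₁u‖_{H^{0,s}} ‖w‖_{H^{1/4,s₀}} ). -/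
open MeasureTheory Real Complex Filter Set

noncomputable section

namespace Aniso

/-- Fundamental domain `(0, 2π]` for the circle of circumference `2π`. -/
def I2pi : Set ℝ := Set.Ioc 0 (2 * π)

/-- Fundamental domain for the 2-torus `𝕋² = (ℝ/2πℤ)²`. -/
def Q2 : Set (ℝ × ℝ) := I2pi ×ˢ I2pi

/-- Integral over the torus of a real function. -/
def tintR (f : ℝ × ℝ → ℝ) : ℝ := ∫ x in Q2, f x

/-- Smoothness of a scalar field. -/
def Smooth (f : ℝ × ℝ → ℝ) : Prop := ContDiff ℝ (⊤ : ℕ∞) f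

/-- Smoothness of a vector field. -/
def SmoothV (u : ℝ × ℝ → ℝ × ℝ) : Prop := ContDiff ℝ (⊤ : ℕ∞) u

/-- `2π`-periodicity in each variable: this encodes being a function on the torus. -/
def Per (f : ℝ × ℝ → ℝ) : Prop :=
  (∀ x : ℝ × ℝ, f (x.1 + 2 * π, x.2) = f x) ∧ (∀ x : ℝ × ℝ, f (x.1, x.2 + 2 * π) = f x)

def PerV (u : ℝ × ℝ → ℝ × ℝ) : Prop :=
  Per (fun x => (u x).1) ∧ Per (fun x => (u x).2)

/-- Partial derivative in the horizontal variable `x₁`. -/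
def pd1 (f : ℝ × ℝ → ℝ) : ℝ × ℝ → ℝ := fun x => fderiv ℝ f x (1, 0)

/-- Partial derivative in the vertical variable `x₂`. -/
def pd2 (f : ℝ × ℝ → ℝ) : ℝ × ℝ → ℝ := fun x => fderiv ℝ f x (0, 1)

def comp1 (u : ℝ × ℝ → ℝ × ℝ) : ℝ × ℝ → ℝ := fun x => (u x).1
def comp2 (u : ℝ × ℝ → ℝ × ℝ) : ℝ × ℝ → ℝ := fun x => (u x).2

def pd1V (u : ℝ × ℝ → ℝ × ℝ) : ℝ × ℝ → ℝ × ℝ := fun x => (pd1 (comp1 u) x, pd1 (comp2 u) x)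
def pd2V (u : ℝ × ℝ → ℝ × ℝ) : ℝ × ℝ → ℝ × ℝ := fun x => (pd2 (comp1 u) x, pd2 (comp2 u) x)

/-- Divergence-free condition `∂₁u¹ + ∂₂u² = 0`. -/
def DivFree (u : ℝ × ℝ → ℝ × ℝ) : Prop :=
  ∀ x, pd1 (comp1 u) x + pd2 (comp2 u) x = 0

/-- The transport term `u·∇v`, with components `u¹∂₁vʲ + u²∂₂vʲ`. -/
def advect (u v : ℝ × ℝ → ℝ × ℝ) : ℝ × ℝ → ℝ × ℝ := fun x =>
  ((u x).1 * pd1 (comp1 v) x + (u x).2 * pd2 (comp1 v) x,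
   (u x).1 * pd1 (comp2 v) x + (u x).2 * pd2 (comp2 v) x)

/-- L² inner product of real vector fields on the torus (summed over components). -/
def ipV (u v : ℝ × ℝ → ℝ × ℝ) : ℝ := tintR fun x => (u x).1 * (v x).1 + (u x).2 * (v x).2

/-- The trilinear form `b(u,v,w) = ∫ (u·∇v)·w`. -/
def b3 (u v w : ℝ × ℝ → ℝ × ℝ) : ℝ := ipV (advect u v) w

/-- L² norm of a scalar function on the torus. -/
def L2 (f : ℝ × ℝ → ℝ) : ℝ := Real.sqrt (tintR fun x => f x ^ 2)

/-- L² norm of a vector field on the torus. -/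
def L2V (u : ℝ × ℝ → ℝ × ℝ) : ℝ := Real.sqrt (tintR fun x => (u x).1 ^ 2 + (u x).2 ^ 2)

/-- Fourier coefficient of a complex-valued function on the torus. -/
def fcC (f : ℝ × ℝ → ℂ) (k : ℤ × ℤ) : ℂ :=
  (1 / (2 * π) ^ 2 : ℂ) *
    ∫ x in Q2, f x * Complex.exp (-(Complex.I) * ((k.1 : ℂ) * (x.1 : ℂ) + (k.2 : ℂ) * (x.2 : ℂ)))

/-- Fourier coefficient of a real-valued function on the torus. -/
def fc (f : ℝ × ℝ → ℝ) (k : ℤ × ℤ) : ℂ := fcC (fun x => (f x : ℂ)) k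

/-- Anisotropic Sobolev weight `(1+|k₁|²)^s (1+|k₂|²)^{s'}`. -/
def aw (s s' : ℝ) (k : ℤ × ℤ) : ℝ :=
  (1 + (k.1 : ℝ) ^ 2) ^ s * (1 + (k.2 : ℝ) ^ 2) ^ s'

/-- Square of the anisotropic Sobolev norm `H^{s,s'}` of a scalar function. -/
def HSq (s s' : ℝ) (f : ℝ × ℝ → ℝ) : ℝ := ∑' k : ℤ × ℤ, aw s s' k * ‖fc f k‖ ^ 2

/-- Anisotropic Sobolev norm `H^{s,s'}` of a scalar function. -/
def HN (s s' : ℝ) (f : ℝ × ℝ → ℝ) : ℝ := Real.sqrt (HSq s s' f)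

/-- Anisotropic Sobolev norm `H^{s,s'}` of a vector field. -/
def HNV (s s' : ℝ) (u : ℝ × ℝ → ℝ × ℝ) : ℝ :=
  Real.sqrt (HSq s s' (comp1 u) + HSq s s' (comp2 u))

/-- Mixed norm `L^∞_h(L²_v)`. -/
def LinfhL2v (f : ℝ × ℝ → ℝ) : ℝ :=
  essSup (fun x1 : ℝ => Real.sqrt (∫ x2 in I2pi, f (x1, x2) ^ 2)) (volume.restrict I2pi)

/-- Mixed norm `L²_h(L^∞_v)`. -/
def L2hLinfv (f : ℝ × ℝ → ℝ) : ℝ :=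
  Real.sqrt (∫ x1 in I2pi, (essSup (fun x2 : ℝ => |f (x1, x2)|) (volume.restrict I2pi)) ^ 2)

/-- Mixed norm `L²_v(L^{4/3}_h)`. -/
def L2vL43h {E : Type*} [NormedAddCommGroup E] (f : ℝ × ℝ → E) : ℝ :=
  Real.sqrt (∫ x2 in I2pi, (∫ x1 in I2pi, ‖f (x1, x2)‖ ^ ((4 : ℝ)/3)) ^ ((3 : ℝ)/2))

/-- Mixed norm `L^∞_v(L²_h)`. -/
def LinfvL2h {E : Type*} [NormedAddCommGroup E] (f : ℝ × ℝ → E) : ℝ :=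
  essSup (fun x2 : ℝ => Real.sqrt (∫ x1 in I2pi, ‖f (x1, x2)‖ ^ 2)) (volume.restrict I2pi)

/-- Mixed norm `L²_v(L⁴_h)`. -/
def L2vL4h {E : Type*} [NormedAddCommGroup E] (f : ℝ × ℝ → E) : ℝ :=
  Real.sqrt (∫ x2 in I2pi, Real.sqrt (∫ x1 in I2pi, ‖f (x1, x2)‖ ^ 4))

/-- One-dimensional Fourier coefficient on the circle of circumference `2π`. -/
def fc1 (g : ℝ → ℂ) (n : ℤ) : ℂ :=
  (1 / (2 * π) : ℂ) * ∫ x in I2pi, g x * Complex.exp (-(Complex.I) * ((n : ℂ) * (x : ℂ)))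

/-- Square of the 1-d Sobolev norm `H^s(𝕋)`. -/
def H1Sq (s : ℝ) (g : ℝ → ℂ) : ℝ := ∑' n : ℤ, (1 + (n : ℝ) ^ 2) ^ s * ‖fc1 g n‖ ^ 2

/-- Mixed norm `L²_v(H^s_h)`. -/
def L2vHsh (s : ℝ) (f : ℝ × ℝ → ℂ) : ℝ :=
  Real.sqrt (∫ x2 in I2pi, H1Sq s (fun x1 => f (x1, x2)))

/-- A dyadic partition of unity `(χ, θ)` on `ℝ`. -/
structure IsDyadicPartition (χ θ : ℝ → ℝ) : Prop where
  smooth_chi : ContDiff ℝ (⊤ : ℕ∞) χ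
  smooth_theta : ContDiff ℝ (⊤ : ℕ∞) θ
  nonneg_chi : ∀ z, 0 ≤ χ z
  nonneg_theta : ∀ z, 0 ≤ θ z
  even_chi : ∀ z, χ (-z) = χ z
  even_theta : ∀ z, θ (-z) = θ z
  chi_support : ∃ R > 0, ∀ z, R ≤ |z| → χ z = 0
  theta_support : ∃ r R : ℝ, 0 < r ∧ r < R ∧ ∀ z, (|z| < r ∨ R < |z|) → θ z = 0
  partition : ∀ z : ℝ, χ z + ∑' j : ℕ, θ ((2 : ℝ) ^ (-(j : ℤ)) * z) = 1
  chi_theta_disj : ∀ j : ℕ, 1 ≤ j → ∀ z, χ z * θ ((2 : ℝ) ^ (-(j : ℤ)) * z) = 0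
  theta_theta_disj : ∀ i j : ℕ, 1 < |(i : ℤ) - (j : ℤ)| → ∀ z,
    θ ((2 : ℝ) ^ (-(i : ℤ)) * z) * θ ((2 : ℝ) ^ (-(j : ℤ)) * z) = 0

/-- The Fourier multiplier symbol of the vertical Littlewood–Paley block `Δ^v_j`. -/
def blockSymb (χ θ : ℝ → ℝ) (j : ℤ) (z : ℝ) : ℝ :=
  if j = -1 then χ |z| else if 0 ≤ j then θ ((2 : ℝ) ^ (-j) * |z|) else 0

/-- The Fourier multiplier symbol of the vertical low-frequency cut-off `S^v_j`. -/
def lowSymb (χ θ : ℝ → ℝ) (j : ℤ) (z : ℝ) : ℝ :=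
  ∑ j' ∈ Finset.Icc (-1 : ℤ) (j - 2), blockSymb χ θ j' z

/-- The character `e^{ik·x}`. -/
def eK (k : ℤ × ℤ) (x : ℝ × ℝ) : ℂ :=
  Complex.exp (Complex.I * ((k.1 : ℂ) * (x.1 : ℂ) + (k.2 : ℂ) * (x.2 : ℂ)))

/-- Vertical Littlewood–Paley block `Δ^v_j` of a complex-valued function. -/
def LPC (χ θ : ℝ → ℝ) (j : ℤ) (f : ℝ × ℝ → ℂ) : ℝ × ℝ → ℂ :=
  fun x => ∑' k : ℤ × ℤ, (blockSymb χ θ j k.2 : ℂ) * fcC f k * eK k x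

/-- Vertical Littlewood–Paley block `Δ^v_j` of a real-valued function. -/
def LP (χ θ : ℝ → ℝ) (j : ℤ) (f : ℝ × ℝ → ℝ) : ℝ × ℝ → ℂ :=
  LPC χ θ j fun x => (f x : ℂ)

/-- Vertical low-frequency cut-off `S^v_j` of a complex-valued function. -/
def SvC (χ θ : ℝ → ℝ) (j : ℤ) (f : ℝ × ℝ → ℂ) : ℝ × ℝ → ℂ :=
  fun x => ∑' k : ℤ × ℤ, (lowSymb χ θ j k.2 : ℂ) * fcC f k * eK k x

/-- Vertical low-frequency cut-off `S^v_j` of a real-valued function. -/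
def Sv (χ θ : ℝ → ℝ) (j : ℤ) (f : ℝ × ℝ → ℝ) : ℝ × ℝ → ℂ :=
  SvC χ θ j fun x => (f x : ℂ)

/-- Componentwise Littlewood–Paley block of a vector field. -/
def LPV (χ θ : ℝ → ℝ) (j : ℤ) (u : ℝ × ℝ → ℝ × ℝ) : ℝ × ℝ → ℂ × ℂ :=
  fun x => (LP χ θ j (comp1 u) x, LP χ θ j (comp2 u) x)

/-- Componentwise low-frequency cut-off of a vector field. -/
def SvV (χ θ : ℝ → ℝ) (j : ℤ) (u : ℝ × ℝ → ℝ × ℝ) : ℝ × ℝ → ℂ × ℂ :=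
  fun x => (Sv χ θ j (comp1 u) x, Sv χ θ j (comp2 u) x)

/-- L² inner product of complex-valued functions on the torus. -/
def ipC (f g : ℝ × ℝ → ℂ) : ℂ := ∫ x in Q2, f x * (starRingEnd ℂ) (g x)

/-- L² inner product of complex vector fields on the torus (summed over components). -/
def ipCV (f g : ℝ × ℝ → ℂ × ℂ) : ℂ :=
  ∫ x in Q2, ((f x).1 * (starRingEnd ℂ) ((g x).1) + (f x).2 * (starRingEnd ℂ) ((g x).2))

/-- The vertical paraproduct `T^v_a g = Σ_j S^v_{j-1}a · Δ^v_j g`. -/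
def Tv (χ θ : ℝ → ℝ) (a g : ℝ × ℝ → ℝ) : ℝ × ℝ → ℂ :=
  fun x => ∑' j : ℤ, Sv χ θ (j - 1) a x * LP χ θ j g x

/-- The vertical remainder `R^v(a,g) = Σ_{|j-j'|≤1} Δ^v_j a · Δ^v_{j'} g`. -/
def Rv (χ θ : ℝ → ℝ) (a g : ℝ × ℝ → ℝ) : ℝ × ℝ → ℂ :=
  fun x => ∑' p : ℤ × ℤ, if |p.1 - p.2| ≤ 1 then LP χ θ p.1 a x * LP χ θ p.2 g x else 0


open scoped ENNReal NNReal

/-- The `ℓ²` norm of an extended nonnegative sequence. -/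
def l2 {ι : Type*} (f : ι → ℝ≥0∞) : ℝ≥0∞ := (∑' i, f i ^ 2) ^ (1 / 2 : ℝ)

lemma l2_sq {ι : Type*} (f : ι → ℝ≥0∞) : l2 f ^ 2 = ∑' i, f i ^ 2 := by
  rw [l2, ← ENNReal.rpow_natCast, ← ENNReal.rpow_mul]
  norm_num

lemma tsum_mul_le_l2 {ι : Type*} (f g : ι → ℝ≥0∞) : ∑' i, f i * g i ≤ l2 f * l2 g := by
  rw [ENNReal.tsum_eq_iSup_sum]
  refine iSup_le fun F => ?_
  refine (ENNReal.inner_le_Lp_mul_Lq F f g Real.HolderConjugate.two_two).trans ?_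
  simp only [ENNReal.rpow_two, l2]
  gcongr <;> exact ENNReal.sum_le_tsum F

lemma l2_le_of_sq_le {ι : Type*} {f : ι → ℝ≥0∞} {a : ℝ≥0∞} (h : ∑' i, f i ^ 2 ≤ a ^ 2) :
    l2 f ≤ a := by
  rw [← l2_sq] at h
  exact (ENNReal.pow_le_pow_left_iff two_ne_zero).1 h

lemma l2_comp_equiv {ι κ : Type*} (e : ι ≃ κ) (f : κ → ℝ≥0∞) : l2 (fun i => f (e i)) = l2 f := by
  rw [l2, l2, e.tsum_eq fun i => f i ^ 2]

lemma l2_prod {ι κ : Type*} (f : ι × κ → ℝ≥0∞) :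
    l2 (fun j => l2 fun i => f (i, j)) = l2 f := by
  unfold l2
  congr 1
  rw [ENNReal.tsum_prod', ENNReal.tsum_comm]
  refine tsum_congr fun j => ?_
  exact l2_sq fun i => f (i, j)

/-- The kernel `K` defines a trilinear form on `ℓ² × ℓ² × ℓ²` bounded by `C`. -/
def TriBound {G : Type*} [AddCommGroup G] (K : G → G → ℝ≥0∞) (C : ℝ≥0∞) : Prop :=
  ∀ P Q Z : G → ℝ≥0∞, ∑' k, ∑' n, K k n * P n * Q (k - n) * Z k ≤ C * l2 P * l2 Q * l2 Z

lemma TriBound.of_row {G : Type*} [AddCommGroup G] {K : G → G → ℝ≥0∞} {C : ℝ≥0∞}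
    (h : ∀ k, ∑' n, K k n ^ 2 ≤ C ^ 2) : TriBound K C := by
  intro P Q Z
  calc ∑' k, ∑' n, K k n * P n * Q (k - n) * Z k
      = ∑' k, (∑' n, K k n * (P n * Q (k - n))) * Z k := by
        refine tsum_congr fun k => ?_
        rw [← ENNReal.tsum_mul_right]
        exact tsum_congr fun n => by ring
    _ ≤ l2 (fun k => ∑' n, K k n * (P n * Q (k - n))) * l2 Z := tsum_mul_le_l2 _ _
    _ ≤ C * l2 P * l2 Q * l2 Z := by
        gcongr
        apply l2_le_of_sq_le
        calc ∑' k, (∑' n, K k n * (P n * Q (k - n))) ^ 2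
            ≤ ∑' k, C ^ 2 * ∑' n, P n ^ 2 * Q (k - n) ^ 2 := by
              refine ENNReal.tsum_le_tsum fun k => ?_
              refine (pow_le_pow_left₀ zero_le (tsum_mul_le_l2 _ _) 2).trans ?_
              rw [mul_pow, l2_sq, l2_sq]
              simp only [mul_pow]
              gcongr
              exact h k
          _ = (C * l2 P * l2 Q) ^ 2 := by
              rw [ENNReal.tsum_mul_left, ENNReal.tsum_comm, mul_pow, mul_pow, l2_sq, l2_sq,
                mul_assoc, ← ENNReal.tsum_mul_right]
              congr 1
              refine tsum_congr fun n => ?_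
              rw [ENNReal.tsum_mul_left]
              congr 1
              exact (Equiv.subRight n).tsum_eq fun i => Q i ^ 2

lemma TriBound.of_column {G : Type*} [AddCommGroup G] {K : G → G → ℝ≥0∞} {C : ℝ≥0∞}
    (h : ∀ n, ∑' k, K k n ^ 2 ≤ C ^ 2) : TriBound K C := by
  intro P Q Z
  have := TriBound.of_row (K := fun n k => K k n) h Z (fun m => Q (-m)) P
  rw [ENNReal.tsum_comm]
  calc _ = ∑' n, ∑' k, K k n * Z k * Q (-(n - k)) * P n := by
        refine tsum_congr fun n => tsum_congr fun k => ?_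
        rw [neg_sub]; ring
    _ ≤ _ := this
    _ = C * l2 P * l2 Q * l2 Z := by
        rw [show l2 (fun m => Q (-m)) = l2 Q from l2_comp_equiv (Equiv.neg G) Q]; ring

lemma TriBound.add {G : Type*} [AddCommGroup G] {K K₁ K₂ : G → G → ℝ≥0∞} {C₁ C₂ : ℝ≥0∞}
    (h₁ : TriBound K₁ C₁) (h₂ : TriBound K₂ C₂) (h : ∀ k n, K k n ≤ K₁ k n + K₂ k n) :
    TriBound K (C₁ + C₂) := by
  intro P Q Z
  calc ∑' k, ∑' n, K k n * P n * Q (k - n) * Z k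
      ≤ ∑' k, ∑' n, (K₁ k n * P n * Q (k - n) * Z k + K₂ k n * P n * Q (k - n) * Z k) := by
        refine ENNReal.tsum_le_tsum fun k => ENNReal.tsum_le_tsum fun n => ?_
        simp only [← add_mul]
        gcongr
        exact h k n
    _ = ∑' k, ∑' n, K₁ k n * P n * Q (k - n) * Z k
        + ∑' k, ∑' n, K₂ k n * P n * Q (k - n) * Z k := by
        simp only [ENNReal.tsum_add]
    _ ≤ _ := by
        simp only [add_mul]
        exact add_le_add (h₁ P Q Z) (h₂ P Q Z)

lemma TriBound.prod {G H : Type*} [AddCommGroup G] [AddCommGroup H] {K₁ : G → G → ℝ≥0∞}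
    {K₂ : H → H → ℝ≥0∞} {C₁ C₂ : ℝ≥0∞} (h₁ : TriBound K₁ C₁) (h₂ : TriBound K₂ C₂) :
    TriBound (fun k n : G × H => K₁ k.1 n.1 * K₂ k.2 n.2) (C₁ * C₂) := by
  intro P Q Z
  calc ∑' k : G × H, ∑' n : G × H, K₁ k.1 n.1 * K₂ k.2 n.2 * P n * Q (k - n) * Z k
      = ∑' k₂, ∑' n₂, K₂ k₂ n₂ * ∑' k₁, ∑' n₁,
          K₁ k₁ n₁ * P (n₁, n₂) * Q (k₁ - n₁, k₂ - n₂) * Z (k₁, k₂) := by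
        simp only [ENNReal.tsum_prod']
        rw [ENNReal.tsum_comm]
        refine tsum_congr fun k₂ => ?_
        simp only [← ENNReal.tsum_mul_left]
        rw [ENNReal.tsum_comm (α := H)]
        refine tsum_congr fun k₁ => ?_
        rw [ENNReal.tsum_comm]
        refine tsum_congr fun n₂ => tsum_congr fun n₁ => ?_
        simp only [Prod.mk_sub_mk]
        ring
    _ ≤ ∑' k₂, ∑' n₂, K₂ k₂ n₂ * (C₁ * l2 (fun n₁ => P (n₁, n₂)) *
          l2 (fun m₁ => Q (m₁, k₂ - n₂)) * l2 (fun k₁ => Z (k₁, k₂))) := by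
        refine ENNReal.tsum_le_tsum fun k₂ => ENNReal.tsum_le_tsum fun n₂ => ?_
        gcongr
        exact h₁ (fun n₁ => P (n₁, n₂)) (fun m₁ => Q (m₁, k₂ - n₂)) (fun k₁ => Z (k₁, k₂))
    _ = C₁ * ∑' k₂, ∑' n₂, K₂ k₂ n₂ * l2 (fun n₁ => P (n₁, n₂)) *
          l2 (fun m₁ => Q (m₁, k₂ - n₂)) * l2 (fun k₁ => Z (k₁, k₂)) := by
        simp only [← ENNReal.tsum_mul_left]
        refine tsum_congr fun k₂ => tsum_congr fun n₂ => ?_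
        ring
    _ ≤ C₁ * (C₂ * l2 P * l2 Q * l2 Z) := by
        gcongr
        rw [← l2_prod P, ← l2_prod Q, ← l2_prod Z]
        exact h₂ (fun n₂ => l2 fun n₁ => P (n₁, n₂)) (fun m₂ => l2 fun m₁ => Q (m₁, m₂))
          (fun k₂ => l2 fun k₁ => Z (k₁, k₂))
    _ = C₁ * C₂ * l2 P * l2 Q * l2 Z := by ring

lemma sum_range_sqrt_inv_le (N : ℕ) :
    ∑ i ∈ Finset.range N, (Real.sqrt (i + 1))⁻¹ ≤ 2 * Real.sqrt N := by
  induction N with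
  | zero => simp
  | succ N ih =>
    rw [Finset.sum_range_succ]
    push_cast
    have h1 : 0 < Real.sqrt (N + 1) := Real.sqrt_pos.2 (by positivity)
    have h2 : 0 ≤ Real.sqrt (N : ℝ) := Real.sqrt_nonneg _
    have h3 := Real.sq_sqrt (show (0 : ℝ) ≤ N + 1 by positivity)
    have h4 := Real.sq_sqrt (show (0 : ℝ) ≤ N by positivity)
    have : (Real.sqrt (N + 1 : ℝ))⁻¹ ≤ 2 * Real.sqrt (N + 1) - 2 * Real.sqrt N := by
      rw [inv_le_iff_one_le_mul₀ h1]
      nlinarith [sq_nonneg (Real.sqrt (N + 1 : ℝ) - Real.sqrt N)]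
    linarith

lemma one_add_sq_rpow_neg_le (i : ℕ) :
    (1 + ((i : ℝ) + 1) ^ 2) ^ (-(1 / 4) : ℝ) ≤ (Real.sqrt (i + 1))⁻¹ := by
  rw [Real.rpow_neg (by positivity)]
  apply inv_anti₀ (Real.sqrt_pos.2 (by positivity))
  have : Real.sqrt ((i : ℝ) + 1) = (((i : ℝ) + 1) ^ 2) ^ (1 / 4 : ℝ) := by
    rw [Real.sqrt_eq_rpow, ← Real.rpow_natCast, ← Real.rpow_mul (by positivity)]
    norm_num
  rw [this]
  exact Real.rpow_le_rpow (by positivity) (by linarith) (by norm_num)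

lemma sum_Icc_one_add_sq_rpow_le (k : ℤ) :
    ∑ n ∈ Finset.Icc (-|k|) |k|, (1 + (n : ℝ) ^ 2) ^ (-(1 / 4) : ℝ) ≤
      5 * (1 + (k : ℝ) ^ 2) ^ (1 / 4 : ℝ) := by
  have key : ∀ N : ℕ, ∑ n ∈ Finset.Icc (-(N : ℤ)) N, (1 + (n : ℝ) ^ 2) ^ (-(1 / 4) : ℝ) =
      1 + 2 * ∑ i ∈ Finset.range N, (1 + ((i : ℝ) + 1) ^ 2) ^ (-(1 / 4) : ℝ) := by
    intro N
    induction N with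
    | zero => simp
    | succ N ih =>
      have hI : Finset.Icc (-((N + 1 : ℕ) : ℤ)) ((N + 1 : ℕ) : ℤ) =
          insert ((N : ℤ) + 1) (insert (-((N : ℤ) + 1)) (Finset.Icc (-(N : ℤ)) N)) := by
        ext x; simp only [Finset.mem_Icc, Finset.mem_insert]; push_cast; omega
      rw [hI, Finset.sum_insert, Finset.sum_insert, ih, Finset.sum_range_succ]
      · push_cast
        rw [neg_sq]
        ring
      · simp
      · simp; omega
  have hk : ((k.natAbs : ℕ) : ℤ) = |k| := by simp
  rw [← hk, key]
  have h1 := Finset.sum_le_sum fun i (_ : i ∈ Finset.range k.natAbs) => one_add_sq_rpow_neg_le i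
  have h2 := sum_range_sqrt_inv_le k.natAbs
  have h3 : Real.sqrt (k.natAbs : ℝ) ≤ (1 + (k : ℝ) ^ 2) ^ (1 / 4 : ℝ) := by
    have : Real.sqrt (k.natAbs : ℝ) = ((k : ℝ) ^ 2) ^ (1 / 4 : ℝ) := by
      rw [← sq_abs, Real.sqrt_eq_rpow, ← Real.rpow_natCast, ← Real.rpow_mul (by positivity)]
      rw [Nat.cast_natAbs, Int.cast_abs]
      norm_num
    rw [this]
    exact Real.rpow_le_rpow (by positivity) (by linarith) (by norm_num)
  have h4 : 1 ≤ (1 + (k : ℝ) ^ 2) ^ (1 / 4 : ℝ) :=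
    Real.one_le_rpow (by nlinarith [sq_nonneg (k : ℝ)]) (by norm_num)
  linarith

/-- The inhomogeneous weight `(1 + n²)^a`. -/
def jap (a : ℝ) (n : ℤ) : ℝ := (1 + (n : ℝ) ^ 2) ^ a

lemma jap_pos (a : ℝ) (n : ℤ) : 0 < jap a n := by unfold jap; positivity

lemma jap_add (a b : ℝ) (n : ℤ) : jap (a + b) n = jap a n * jap b n :=
  Real.rpow_add (by positivity) _ _

lemma jap_zero (n : ℤ) : jap 0 n = 1 := Real.rpow_zero _

lemma jap_neg_mul (a : ℝ) (n : ℤ) : jap (-a) n * jap a n = 1 := by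
  rw [← jap_add, neg_add_cancel, jap_zero]

lemma tsum_kernel_le (k : ℤ) :
    ∑' n : ℤ, (if |n| ≤ |k| then ENNReal.ofReal (jap (-(1 / 8)) k * jap (-(1 / 8)) n) else 0) ^ 2 ≤
      ENNReal.ofReal 5 := by
  rw [tsum_eq_sum (s := Finset.Icc (-|k|) |k|)]
  · calc _ = ∑ n ∈ Finset.Icc (-|k|) |k|,
          ENNReal.ofReal (jap (-(1 / 4)) k * jap (-(1 / 4)) n) := by
          refine Finset.sum_congr rfl fun n hn => ?_
          rw [if_pos (abs_le.2 (Finset.mem_Icc.1 hn)), ← ENNReal.ofReal_pow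
            (mul_nonneg (jap_pos _ _).le (jap_pos _ _).le)]
          congr 1
          rw [show (-(1 / 4) : ℝ) = -(1 / 8) + -(1 / 8) by norm_num, jap_add, jap_add]
          ring
      _ = ENNReal.ofReal (jap (-(1 / 4)) k * ∑ n ∈ Finset.Icc (-|k|) |k|, jap (-(1 / 4)) n) := by
          rw [Finset.mul_sum, ENNReal.ofReal_sum_of_nonneg]
          exact fun n _ => mul_nonneg (jap_pos _ _).le (jap_pos _ _).le
      _ ≤ _ := by
          apply ENNReal.ofReal_le_ofReal
          calc _ ≤ jap (-(1 / 4)) k * (5 * jap (1 / 4) k) :=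
                mul_le_mul_of_nonneg_left (sum_Icc_one_add_sq_rpow_le k) (jap_pos _ _).le
            _ = 5 * (jap (-(1 / 4)) k * jap (1 / 4) k) := by ring
            _ = 5 := by rw [jap_neg_mul, mul_one]
  · intro n hn
    rw [if_neg, zero_pow two_ne_zero]
    rwa [abs_le, ← Finset.mem_Icc]

lemma triBound_horizontal :
    TriBound (fun k n : ℤ => ENNReal.ofReal (jap (-(1 / 8)) k * jap (-(1 / 8)) n)) (5 + 5) := by
  have h5 : ENNReal.ofReal 5 ≤ 5 ^ 2 := by
    rw [ENNReal.ofReal_ofNat]; norm_num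
  refine TriBound.add
    (TriBound.of_row (K := fun k n : ℤ => if |n| ≤ |k| then
      ENNReal.ofReal (jap (-(1 / 8)) k * jap (-(1 / 8)) n) else 0)
      fun k => (tsum_kernel_le k).trans h5)
    (TriBound.of_column (K := fun k n : ℤ => if |k| ≤ |n| then
      ENNReal.ofReal (jap (-(1 / 8)) n * jap (-(1 / 8)) k) else 0)
      fun k => (tsum_kernel_le k).trans h5) fun k n => ?_
  rcases le_total |n| |k| with h | h
  · simp only [if_pos h]; exact le_self_add
  · simp only [if_pos h]; rw [mul_comm]; exact le_add_self

lemma summable_jap {a : ℝ} (ha : a < -(1 / 2)) : Summable (jap a) := by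
  have h := (summable_abs_int_rpow (b := -2 * a) (by linarith))
  have h0 : Summable fun n : ℤ => if n = 0 then (1 : ℝ) else 0 :=
    summable_of_ne_finset_zero (s := {0}) fun b hb => by simp at hb; simp [hb]
  refine Summable.of_nonneg_of_le (fun n => (jap_pos a n).le) (fun n => ?_) (h.add h0)
  by_cases hn : n = 0
  · subst hn
    simp only [jap, Int.cast_zero, if_true]
    norm_num
    positivity
  · have hn' : 0 < |(n : ℝ)| := abs_pos.2 (by exact_mod_cast hn)
    rw [if_neg hn, add_zero]
    calc jap a n ≤ ((n : ℝ) ^ 2) ^ a := by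
          apply Real.rpow_le_rpow_of_nonpos (by rw [← sq_abs]; positivity) (by linarith)
            (by linarith)
      _ = |(n : ℝ)| ^ (-(-2 * a)) := by
          rw [← sq_abs, ← Real.rpow_natCast, ← Real.rpow_mul (by positivity)]
          norm_num

lemma exists_tsum_jap_le {s₀ : ℝ} (hs₀ : 1 / 2 < s₀) : ∃ C : ℝ≥0∞, C ≠ ∞ ∧
    ∑' n, ENNReal.ofReal (jap (-(s₀ / 2)) n) ^ 2 ≤ C ^ 2 := by
  have hs := summable_jap (a := -s₀) (by linarith)
  have : ∑' n, ENNReal.ofReal (jap (-(s₀ / 2)) n) ^ 2 = ENNReal.ofReal (∑' n, jap (-s₀) n) := by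
    rw [ENNReal.ofReal_tsum_of_nonneg (fun n => (jap_pos _ _).le) hs]
    refine tsum_congr fun n => ?_
    rw [← ENNReal.ofReal_pow (jap_pos _ _).le]
    congr 1
    rw [sq, ← jap_add]
    congr 1
    ring
  refine ⟨ENNReal.ofReal (∑' n, jap (-s₀) n) + 1, by simp, ?_⟩
  rw [this]
  calc ENNReal.ofReal (∑' n, jap (-s₀) n) ≤ ENNReal.ofReal (∑' n, jap (-s₀) n) + 1 := le_self_add
    _ ≤ _ := by
      rw [sq]
      exact le_mul_of_one_le_left zero_le le_add_self

lemma exists_triBound {s₀ : ℝ} (hs₀ : 1 / 2 < s₀) : ∃ C : ℝ≥0∞, C ≠ ∞ ∧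
    TriBound (fun k n : ℤ × ℤ => ENNReal.ofReal (jap (-(1 / 8)) k.1 * jap (-(1 / 8)) n.1) *
      ENNReal.ofReal (jap (-(s₀ / 2)) n.2)) C ∧
    TriBound (fun k n : ℤ × ℤ => ENNReal.ofReal (jap (-(1 / 8)) k.1 * jap (-(1 / 8)) n.1) *
      ENNReal.ofReal (jap (-(s₀ / 2)) (k.2 - n.2))) C := by
  obtain ⟨C, hC, h⟩ := exists_tsum_jap_le hs₀
  refine ⟨(5 + 5) * C, ENNReal.mul_ne_top (by simp) hC, ?_, ?_⟩
  · exact triBound_horizontal.prod (TriBound.of_row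
      (K := fun _ n : ℤ => ENNReal.ofReal (jap (-(s₀ / 2)) n)) fun _ => h)
  · refine triBound_horizontal.prod (TriBound.of_row
      (K := fun k n : ℤ => ENNReal.ofReal (jap (-(s₀ / 2)) (k - n))) fun k => ?_)
    exact ((Equiv.subLeft k).tsum_eq fun n => ENNReal.ofReal (jap (-(s₀ / 2)) n) ^ 2).trans_le h

lemma exists_jap_add_le {s : ℝ} (hs : 0 < s) : ∃ c : ℝ, 0 ≤ c ∧ ∀ k n : ℤ,
    jap (s / 2) k ≤ c * (jap (s / 2) n + jap (s / 2) (k - n)) := by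
  refine ⟨4 ^ (s / 2), by positivity, fun k n => ?_⟩
  have key : ∀ m : ℤ, 1 + (k : ℝ) ^ 2 ≤ 4 * (1 + (m : ℝ) ^ 2) →
      jap (s / 2) k ≤ 4 ^ (s / 2) * jap (s / 2) m := fun m hm => by
    rw [jap, jap, ← Real.mul_rpow (by norm_num) (by positivity)]
    exact Real.rpow_le_rpow (by positivity) hm (by positivity)
  have h1 := jap_pos (s / 2) n
  have h2 := jap_pos (s / 2) (k - n)
  have h3 : (0 : ℝ) < 4 ^ (s / 2) := by positivity
  by_cases h : 1 + (k : ℝ) ^ 2 ≤ 4 * (1 + (n : ℝ) ^ 2)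
  · exact (key n h).trans (by nlinarith)
  · refine (key (k - n) ?_).trans (by nlinarith)
    push_cast
    by_contra h'
    push Not at h h'
    nlinarith [sq_nonneg ((k : ℝ) - 2 * n)]

/-- The anisotropic Sobolev norm of a sequence of Fourier coefficients of modulus `x`. -/
def nrm (a b : ℝ) (x : ℤ × ℤ → ℝ) : ℝ≥0∞ :=
  l2 fun k => ENNReal.ofReal (jap (a / 2) k.1 * jap (b / 2) k.2 * x k)

lemma exists_trilinear_le {s₀ s : ℝ} (hs₀ : 1 / 2 < s₀) (hs : s₀ ≤ s) : ∃ C : ℝ≥0∞, C ≠ ∞ ∧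
    ∀ x y w : ℤ × ℤ → ℝ, 0 ≤ x → 0 ≤ y → 0 ≤ w →
      ∑' k : ℤ × ℤ, ∑' n : ℤ × ℤ, ENNReal.ofReal (jap s k.2 * (x n * y (k - n) * w k)) ≤
        C * nrm (1 / 4) s w *
          (nrm (1 / 4) s x * nrm 0 s₀ y + nrm (1 / 4) s₀ x * nrm 0 s y) := by
  obtain ⟨C, hC, h₁, h₂⟩ := exists_triBound hs₀
  obtain ⟨c, hc, hjap⟩ := exists_jap_add_le (s := s) (by linarith)
  refine ⟨ENNReal.ofReal c * C, ENNReal.mul_ne_top ENNReal.ofReal_ne_top hC,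
    fun x y w hx hy hw => ?_⟩
  set X : ℝ → ℤ × ℤ → ℝ := fun b k => jap (1 / 8) k.1 * jap (b / 2) k.2 * x k with hX
  set Y : ℝ → ℤ × ℤ → ℝ := fun b k => jap (b / 2) k.2 * y k with hY
  set W : ℤ × ℤ → ℝ := fun k => jap (1 / 8) k.1 * jap (s / 2) k.2 * w k with hW
  have hX0 : ∀ b k, 0 ≤ X b k := fun b k =>
    mul_nonneg (mul_nonneg (jap_pos _ _).le (jap_pos _ _).le) (hx k)
  have hY0 : ∀ b k, 0 ≤ Y b k := fun b k => mul_nonneg (jap_pos _ _).le (hy k)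
  have hW0 : ∀ k, 0 ≤ W k := fun k =>
    mul_nonneg (mul_nonneg (jap_pos _ _).le (jap_pos _ _).le) (hw k)
  have nX : ∀ b, l2 (fun k => ENNReal.ofReal (X b k)) = nrm (1 / 4) b x := fun b => by
    simp only [hX, nrm]; norm_num
  have nY : ∀ b, l2 (fun k => ENNReal.ofReal (Y b k)) = nrm 0 b y := fun b => by
    simp only [hY, nrm, zero_div, jap_zero, one_mul]
  have nW : l2 (fun k => ENNReal.ofReal (W k)) = nrm (1 / 4) s w := by
    simp only [hW, nrm]; norm_num
  have e₁ := h₁ (fun k => ENNReal.ofReal (X s₀ k)) (fun k => ENNReal.ofReal (Y s k))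
    (fun k => ENNReal.ofReal (W k))
  have e₂ := h₂ (fun k => ENNReal.ofReal (X s k)) (fun k => ENNReal.ofReal (Y s₀ k))
    (fun k => ENNReal.ofReal (W k))
  rw [nX, nY, nW] at e₁ e₂
  have hpt : ∀ k n : ℤ × ℤ, jap s k.2 * (x n * y (k - n) * w k) ≤
      c * (jap (-(1 / 8)) k.1 * jap (-(1 / 8)) n.1 * jap (-(s₀ / 2)) (k.2 - n.2) *
            X s n * Y s₀ (k - n) * W k +
          jap (-(1 / 8)) k.1 * jap (-(1 / 8)) n.1 * jap (-(s₀ / 2)) n.2 *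
            X s₀ n * Y s (k - n) * W k) := fun k n => by
    have a₁ := jap_neg_mul (1 / 8) k.1
    have a₂ := jap_neg_mul (1 / 8) n.1
    have a₃ := jap_neg_mul (s₀ / 2) n.2
    have a₄ := jap_neg_mul (s₀ / 2) (k.2 - n.2)
    calc jap s k.2 * (x n * y (k - n) * w k)
        = jap (s / 2) k.2 * (jap (s / 2) k.2 * (x n * y (k - n) * w k)) := by
          rw [← mul_assoc (jap (s / 2) k.2), ← jap_add, add_halves]
      _ ≤ c * (jap (s / 2) n.2 + jap (s / 2) (k.2 - n.2)) *
            (jap (s / 2) k.2 * (x n * y (k - n) * w k)) :=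
          mul_le_mul_of_nonneg_right (hjap _ _) (mul_nonneg (jap_pos _ _).le
            (mul_nonneg (mul_nonneg (hx _) (hy _)) (hw _)))
      _ = c * ((jap (-(1 / 8)) k.1 * jap (1 / 8) k.1) * (jap (-(1 / 8)) n.1 * jap (1 / 8) n.1) *
            (jap (-(s₀ / 2)) (k.2 - n.2) * jap (s₀ / 2) (k.2 - n.2)) * jap (s / 2) n.2 *
            (jap (s / 2) k.2 * (x n * y (k - n) * w k)) +
            (jap (-(1 / 8)) k.1 * jap (1 / 8) k.1) * (jap (-(1 / 8)) n.1 * jap (1 / 8) n.1) *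
            (jap (-(s₀ / 2)) n.2 * jap (s₀ / 2) n.2) * jap (s / 2) (k.2 - n.2) *
            (jap (s / 2) k.2 * (x n * y (k - n) * w k))) := by
          rw [a₁, a₂, a₃, a₄]; ring
      _ = _ := by
          simp only [hX, hY, hW, Prod.snd_sub]
          ring
  calc ∑' k : ℤ × ℤ, ∑' n : ℤ × ℤ, ENNReal.ofReal (jap s k.2 * (x n * y (k - n) * w k))
      ≤ ∑' k : ℤ × ℤ, ∑' n : ℤ × ℤ, ENNReal.ofReal c *
        (ENNReal.ofReal (jap (-(1 / 8)) k.1 * jap (-(1 / 8)) n.1) *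
          ENNReal.ofReal (jap (-(s₀ / 2)) (k.2 - n.2)) * ENNReal.ofReal (X s n) *
          ENNReal.ofReal (Y s₀ (k - n)) * ENNReal.ofReal (W k) +
        ENNReal.ofReal (jap (-(1 / 8)) k.1 * jap (-(1 / 8)) n.1) *
          ENNReal.ofReal (jap (-(s₀ / 2)) n.2) * ENNReal.ofReal (X s₀ n) *
          ENNReal.ofReal (Y s (k - n)) * ENNReal.ofReal (W k)) := by
        refine ENNReal.tsum_le_tsum fun k => ENNReal.tsum_le_tsum fun n => ?_
        refine (ENNReal.ofReal_le_ofReal (hpt k n)).trans_eq ?_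
        have p₁ := mul_nonneg (jap_pos (-(1 / 8)) k.1).le (jap_pos (-(1 / 8)) n.1).le
        have p₂ := mul_nonneg p₁ (jap_pos (-(s₀ / 2)) (k.2 - n.2)).le
        have p₃ := mul_nonneg p₁ (jap_pos (-(s₀ / 2)) n.2).le
        have p₄ := mul_nonneg p₂ (hX0 s n)
        have p₅ := mul_nonneg p₃ (hX0 s₀ n)
        have p₆ := mul_nonneg p₄ (hY0 s₀ (k - n))
        have p₇ := mul_nonneg p₅ (hY0 s (k - n))
        rw [ENNReal.ofReal_mul hc, ENNReal.ofReal_add (mul_nonneg p₆ (hW0 k))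
          (mul_nonneg p₇ (hW0 k)), ENNReal.ofReal_mul p₆, ENNReal.ofReal_mul p₄,
          ENNReal.ofReal_mul p₂, ENNReal.ofReal_mul p₁, ENNReal.ofReal_mul p₇,
          ENNReal.ofReal_mul p₅, ENNReal.ofReal_mul p₃, ENNReal.ofReal_mul p₁]
    _ ≤ ENNReal.ofReal c * (C * nrm (1 / 4) s x * nrm 0 s₀ y * nrm (1 / 4) s w +
          C * nrm (1 / 4) s₀ x * nrm 0 s y * nrm (1 / 4) s w) := by
        simp only [ENNReal.tsum_mul_left, ENNReal.tsum_add]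
        gcongr
    _ = _ := by ring

lemma exists_sq_lipschitz {φ : ℝ → ℝ} (hφ : ContDiff ℝ (⊤ : ℕ∞) φ) {R : ℝ}
    (hR : ∀ z, R < |z| → φ z = 0) :
    ∃ M L : ℝ, 0 ≤ M ∧ 0 ≤ L ∧ (∀ z, φ z ^ 2 ≤ M) ∧
      ∀ y z, |φ y ^ 2 - φ z ^ 2| ≤ L * |y - z| := by
  have hsupp : HasCompactSupport fun z => φ z ^ 2 := by
    refine HasCompactSupport.intro (isCompact_Icc (a := -R) (b := R)) fun z hz => ?_
    rw [hR z (by rw [← not_le, abs_le]; exact hz), zero_pow two_ne_zero]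
  have hcd : ContDiff ℝ 1 fun z => φ z ^ 2 := (hφ.of_le (by exact_mod_cast le_top)).pow 2
  obtain ⟨L, hL⟩ := hcd.lipschitzWith_of_hasCompactSupport hsupp one_ne_zero
  obtain ⟨M, hM⟩ := hcd.continuous.bounded_above_of_compact_support hsupp
  refine ⟨M, L, (norm_nonneg _).trans (hM 0), L.2, fun z => (le_abs_self _).trans (hM z),
    fun y z => ?_⟩
  simpa [Real.dist_eq] using hL.dist_le_mul y z

/-- The dyadic blocks are localised at frequency `2^j`, bounded, and have squares with Lipschitz
constant of order `2^{-j}`. -/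
lemma exists_blockSymb_bounds {χ θ : ℝ → ℝ} (hp : IsDyadicPartition χ θ) :
    ∃ M L R c : ℝ, 0 ≤ M ∧ 0 ≤ L ∧ 0 ≤ R ∧ 0 < c ∧ ∀ j : ℤ, -1 ≤ j →
      (∀ z, blockSymb χ θ j z ^ 2 ≤ M) ∧
      (∀ y z, |blockSymb χ θ j y ^ 2 - blockSymb χ θ j z ^ 2| ≤ L * (2 : ℝ) ^ (-j) * |y - z|) ∧
      ∀ z, blockSymb χ θ j z ≠ 0 →
        |z| ≤ R * (2 : ℝ) ^ j ∧ ((2 : ℝ) ^ j) ^ 2 ≤ c * (1 + z ^ 2) := by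
  obtain ⟨R₁, hR₁, hχ⟩ := hp.chi_support
  obtain ⟨r, R₂, hr, hrR, hθ⟩ := hp.theta_support
  obtain ⟨M₁, L₁, hM₁, hL₁, hχM, hχL⟩ := exists_sq_lipschitz hp.smooth_chi
    (fun z hz => hχ z hz.le)
  obtain ⟨M₂, L₂, hM₂, hL₂, hθM, hθL⟩ := exists_sq_lipschitz hp.smooth_theta
    (fun z hz => hθ z (Or.inr hz))
  refine ⟨M₁ + M₂, L₁ + L₂, 2 * R₁ + R₂, 1 + (r ^ 2)⁻¹, by positivity, by positivity,
    by linarith, by positivity, fun j hj => ?_⟩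
  rcases hj.eq_or_lt with rfl | hj'
  · simp only [blockSymb, if_true]
    refine ⟨fun z => by linarith [hχM |z|], fun y z => ?_, fun z hz => ⟨?_, ?_⟩⟩
    · refine (hχL _ _).trans ?_
      have h1 := abs_abs_sub_abs_le_abs_sub y z
      have h2 := abs_nonneg (y - z)
      have h3 : (2 : ℝ) ^ (-(-1) : ℤ) = 2 := by norm_num
      rw [h3]
      calc L₁ * |(|y| - |z|)| ≤ L₁ * |y - z| := by gcongr
        _ ≤ (L₁ + L₂) * 2 * |y - z| := by gcongr; linarith
    · have : |z| < R₁ := by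
        by_contra h
        exact hz (hχ _ (by rw [abs_abs]; exact not_lt.1 h))
      have h3 : (2 : ℝ) ^ (-1 : ℤ) = 1 / 2 := by norm_num
      rw [h3]
      linarith
    · have h3 : (2 : ℝ) ^ (-1 : ℤ) = 1 / 2 := by norm_num
      rw [h3]
      have : 0 < (r ^ 2)⁻¹ := by positivity
      nlinarith [sq_nonneg z, mul_nonneg this.le (sq_nonneg z)]
  · have hj0 : 0 ≤ j := by omega
    have hj1 : j ≠ -1 := by omega
    have h2j : (0 : ℝ) < 2 ^ j := by positivity
    have h2j' : (0 : ℝ) < 2 ^ (-j) := by positivity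
    have hmul : (2 : ℝ) ^ j * 2 ^ (-j) = 1 := by
      rw [← zpow_add₀ two_ne_zero, add_neg_cancel, zpow_zero]
    simp only [blockSymb, if_neg hj1, if_pos hj0]
    refine ⟨fun z => by linarith [hθM ((2 : ℝ) ^ (-j) * |z|)], fun y z => ?_,
      fun z hz => ⟨?_, ?_⟩⟩
    · refine (hθL _ _).trans ?_
      rw [← mul_sub, abs_mul, abs_of_pos h2j', ← mul_assoc]
      have h1 := abs_abs_sub_abs_le_abs_sub y z
      gcongr
      linarith
    · have : 2 ^ (-j) * |z| ≤ R₂ := by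
        by_contra h
        exact hz (hθ _ (Or.inr (by rw [abs_mul, abs_abs, abs_of_pos h2j']; exact not_le.1 h)))
      calc |z| = (2 ^ j * 2 ^ (-j)) * |z| := by rw [hmul, one_mul]
        _ = 2 ^ (-j) * |z| * 2 ^ j := by ring
        _ ≤ (2 * R₁ + R₂) * 2 ^ j := by gcongr; linarith
    · have : r ≤ 2 ^ (-j) * |z| := by
        by_contra h
        exact hz (hθ _ (Or.inl (by rw [abs_mul, abs_abs, abs_of_pos h2j']; exact not_le.1 h)))
      have h4 : r * 2 ^ j ≤ |z| := by
        calc r * 2 ^ j ≤ 2 ^ (-j) * |z| * 2 ^ j := by gcongr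
          _ = (2 ^ j * 2 ^ (-j)) * |z| := by ring
          _ = |z| := by rw [hmul, one_mul]
      have h5 : (r * 2 ^ j) ^ 2 ≤ z ^ 2 := by
        rw [← sq_abs z]; gcongr
      have h6 : ((2 : ℝ) ^ j) ^ 2 = (r ^ 2)⁻¹ * (r * 2 ^ j) ^ 2 := by field_simp
      rw [h6]
      have : 0 < (r ^ 2)⁻¹ := by positivity
      nlinarith [sq_nonneg z, mul_le_mul_of_nonneg_left h5 this.le]

/-- Indicator of the frequencies seen by the block `j`. -/
def blockInd (χ θ : ℝ → ℝ) (j : ℤ) (z : ℝ) : ℝ := if blockSymb χ θ j z = 0 then 0 else 1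

lemma blockInd_nonneg (χ θ : ℝ → ℝ) (j : ℤ) (z : ℝ) : 0 ≤ blockInd χ θ j z := by
  unfold blockInd; split_ifs <;> norm_num

lemma sum_two_pow_le {s : ℝ} (hs : 0 < s) (F : Finset ℤ) (J : ℤ) (hF : ∀ j ∈ F, j ≤ J) :
    ∑ j ∈ F, (2 : ℝ) ^ (2 * (j : ℝ) * s) ≤
      (1 - (2 : ℝ) ^ (-(2 * s)))⁻¹ * (2 : ℝ) ^ (2 * (J : ℝ) * s) := by
  set q : ℝ := (2 : ℝ) ^ (-(2 * s)) with hq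
  have hq0 : 0 < q := by positivity
  have hq1 : q < 1 := Real.rpow_lt_one_of_one_lt_of_neg (by norm_num) (by linarith)
  have hterm : ∀ j ∈ F, (2 : ℝ) ^ (2 * (j : ℝ) * s) =
      q ^ (J - j).toNat * (2 : ℝ) ^ (2 * (J : ℝ) * s) := fun j hj => by
    have : (((J - j).toNat : ℤ) : ℝ) = ((J - j : ℤ) : ℝ) := by
      rw [Int.toNat_of_nonneg (by linarith [hF j hj])]
    rw [hq, ← Real.rpow_natCast, ← Real.rpow_mul (by norm_num), ← Real.rpow_add (by norm_num)]
    congr 1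
    rw [← Int.cast_natCast, this]
    push_cast
    ring
  rw [Finset.sum_congr rfl hterm, ← Finset.sum_mul]
  gcongr
  rw [← tsum_geometric_of_lt_one hq0.le hq1]
  have hinj : Set.InjOn (fun j : ℤ => (J - j).toNat) F := fun a ha b hb h => by
    have := hF a ha
    have := hF b hb
    simp only at h
    omega
  rw [← Finset.sum_image (f := fun i => q ^ i) hinj]
  exact (summable_geometric_of_lt_one hq0.le hq1).sum_le_tsum _ fun i _ => by positivity

lemma exists_sum_blockInd_le {χ θ : ℝ → ℝ} (hp : IsDyadicPartition χ θ) {s : ℝ} (hs : 0 < s) :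
    ∃ C : ℝ, 0 ≤ C ∧ ∀ (F : Finset ℤ) (_ : ∀ j ∈ F, -1 ≤ j) (n : ℤ),
      ∑ j ∈ F, (2 : ℝ) ^ (2 * (j : ℝ) * s) * blockInd χ θ j n ≤ C * jap s n := by
  obtain ⟨M, L, R, c, -, -, -, hc, h⟩ := exists_blockSymb_bounds hp
  have hq1 : (2 : ℝ) ^ (-(2 * s)) < 1 :=
    Real.rpow_lt_one_of_one_lt_of_neg (by norm_num) (by linarith)
  have hq2 : 0 < 1 - (2 : ℝ) ^ (-(2 * s)) := by linarith
  refine ⟨(1 - (2 : ℝ) ^ (-(2 * s)))⁻¹ * c ^ s, by positivity, fun F hF n => ?_⟩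
  classical
  have hfil : ∑ j ∈ F, (2 : ℝ) ^ (2 * (j : ℝ) * s) * blockInd χ θ j n =
      ∑ j ∈ F with blockSymb χ θ j n ≠ 0, (2 : ℝ) ^ (2 * (j : ℝ) * s) := by
    rw [Finset.sum_filter]
    refine Finset.sum_congr rfl fun j _ => ?_
    by_cases h0 : blockSymb χ θ j n = 0 <;> simp [blockInd, h0]
  rw [hfil]
  set F' := F.filter fun j => blockSymb χ θ j n ≠ 0 with hF'
  rcases F'.eq_empty_or_nonempty with h0 | h0
  · rw [h0, Finset.sum_empty]
    unfold jap
    positivity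
  · have hJ := F'.max'_mem h0
    set J := F'.max' h0
    refine (sum_two_pow_le hs F' J fun j hj => F'.le_max' j hj).trans ?_
    rw [mul_assoc _ (c ^ s)]
    refine mul_le_mul_of_nonneg_left ?_ (inv_nonneg.2 hq2.le)
    have hJ' := Finset.mem_filter.1 hJ
    have h2 := ((h J (hF J hJ'.1)).2.2 n hJ'.2).2
    rw [show jap s n = (1 + (n : ℝ) ^ 2) ^ s from rfl, ← Real.mul_rpow hc.le (by positivity)]
    calc (2 : ℝ) ^ (2 * (J : ℝ) * s) = (((2 : ℝ) ^ J) ^ 2) ^ s := by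
          rw [← Real.rpow_intCast, ← Real.rpow_natCast, ← Real.rpow_mul (by positivity),
            ← Real.rpow_mul (by positivity)]
          congr 1
          push_cast
          ring
      _ ≤ _ := Real.rpow_le_rpow (by positivity) h2 hs.le

/-- The commutator bound for the symmetrised symbol. -/
lemma exists_symbol_le {χ θ : ℝ → ℝ} (hp : IsDyadicPartition χ θ) :
    ∃ C : ℝ, 0 ≤ C ∧ ∀ j : ℤ, -1 ≤ j →
      (∀ z, blockSymb χ θ j z ^ 2 ≤ C * blockInd χ θ j z) ∧ ∀ y z,
      |blockSymb χ θ j y ^ 2 * z - blockSymb χ θ j z ^ 2 * y| ≤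
        C * |y - z| * (blockInd χ θ j y + blockInd χ θ j z) := by
  obtain ⟨M, L, R, c, hM, hL, hR, hc, h⟩ := exists_blockSymb_bounds hp
  have key : ∀ j : ℤ, -1 ≤ j → ∀ y z, blockSymb χ θ j y ≠ 0 →
      |blockSymb χ θ j y ^ 2 * z - blockSymb χ θ j z ^ 2 * y| ≤ (M + L * R) * |y - z| := by
    intro j hj y z hy
    obtain ⟨h1, h2, h3⟩ := h j hj
    have h2j : (2 : ℝ) ^ (-j) * 2 ^ j = 1 := by
      rw [← zpow_add₀ two_ne_zero, neg_add_cancel, zpow_zero]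
    have h2j' : (0 : ℝ) < 2 ^ (-j) := by positivity
    calc |blockSymb χ θ j y ^ 2 * z - blockSymb χ θ j z ^ 2 * y|
        = |blockSymb χ θ j y ^ 2 * (z - y) +
            (blockSymb χ θ j y ^ 2 - blockSymb χ θ j z ^ 2) * y| := by ring_nf
      _ ≤ |blockSymb χ θ j y ^ 2| * |z - y| +
            |blockSymb χ θ j y ^ 2 - blockSymb χ θ j z ^ 2| * |y| := by
          rw [← abs_mul, ← abs_mul]; exact abs_add_le _ _
      _ ≤ M * |z - y| + L * (2 : ℝ) ^ (-j) * |y - z| * (R * 2 ^ j) := by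
          gcongr
          · rw [abs_of_nonneg (sq_nonneg _)]; exact h1 y
          · exact h2 y z
          · exact (h3 y hy).1
      _ = (M + L * R * ((2 : ℝ) ^ (-j) * 2 ^ j)) * |y - z| := by rw [abs_sub_comm z y]; ring
      _ = (M + L * R) * |y - z| := by rw [h2j, mul_one]
  refine ⟨M + L * R, by positivity, fun j hj => ⟨fun z => ?_, fun y z => ?_⟩⟩
  · by_cases hz : blockSymb χ θ j z = 0
    · simp [blockInd, hz]
    · simp only [blockInd, hz, if_false, mul_one]
      have := (h j hj).1 z
      have : 0 ≤ L * R := by positivity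
      linarith
  · have h0 : 0 ≤ (M + L * R) * |y - z| := by positivity
    have i1 := blockInd_nonneg χ θ j y
    have i2 := blockInd_nonneg χ θ j z
    by_cases hy : blockSymb χ θ j y = 0
    · by_cases hz : blockSymb χ θ j z = 0
      · simp [hy, hz, blockInd]
      · have := key j hj z y hz
        rw [abs_sub_comm, abs_sub_comm z y] at this
        have e : blockInd χ θ j z = 1 := by simp [blockInd, hz]
        refine this.trans (le_mul_of_one_le_right h0 (by linarith))
    · have e : blockInd χ θ j y = 1 := by simp [blockInd, hy]
      exact (key j hj y z hy).trans (le_mul_of_one_le_right h0 (by linarith))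

/-- Smooth complex-valued functions on the torus. -/
structure SmoothPer (F : ℝ × ℝ → ℂ) : Prop where
  smooth : ContDiff ℝ (⊤ : ℕ∞) F
  per₁ : ∀ x : ℝ × ℝ, F (x.1 + 2 * π, x.2) = F x
  per₂ : ∀ x : ℝ × ℝ, F (x.1, x.2 + 2 * π) = F x

/-- The directional derivative along `v`. -/
def dv (v : ℝ × ℝ) (F : ℝ × ℝ → ℂ) : ℝ × ℝ → ℂ := fun x => fderiv ℝ F x v

lemma SmoothPer.continuous {F : ℝ × ℝ → ℂ} (hF : SmoothPer F) : Continuous F :=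
  hF.smooth.continuous

lemma SmoothPer.differentiable {F : ℝ × ℝ → ℂ} (hF : SmoothPer F) : Differentiable ℝ F :=
  hF.smooth.differentiable (by simp)

lemma SmoothPer.dv {F : ℝ × ℝ → ℂ} (hF : SmoothPer F) (v : ℝ × ℝ) : SmoothPer (dv v F) := by
  have key : ∀ a : ℝ × ℝ, (∀ x, F (x + a) = F x) → ∀ x, fderiv ℝ F (x + a) = fderiv ℝ F x := by
    intro a ha x
    rw [← fderiv_comp_add_right a]
    congr 1
    exact funext ha
  refine ⟨(hF.smooth.fderiv_right (m := (⊤ : ℕ∞)) (by simp)).clm_apply contDiff_const,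
    fun x => ?_, fun x => ?_⟩
  · have := key (2 * π, 0) (fun x => by rw [← hF.per₁ x]; congr 1; ext <;> simp) x
    simp only [Aniso.dv]
    rw [← this]
    congr 2
    ext <;> simp
  · have := key (0, 2 * π) (fun x => by rw [← hF.per₂ x]; congr 1; ext <;> simp) x
    simp only [Aniso.dv]
    rw [← this]
    congr 2
    ext <;> simp

lemma SmoothPer.mul {F G : ℝ × ℝ → ℂ} (hF : SmoothPer F) (hG : SmoothPer G) :
    SmoothPer fun x => F x * G x :=
  ⟨hF.smooth.mul hG.smooth, fun x => by simp only [hF.per₁, hG.per₁],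
    fun x => by simp only [hF.per₂, hG.per₂]⟩

lemma SmoothPer.add {F G : ℝ × ℝ → ℂ} (hF : SmoothPer F) (hG : SmoothPer G) :
    SmoothPer fun x => F x + G x :=
  ⟨hF.smooth.add hG.smooth, fun x => by simp only [hF.per₁, hG.per₁],
    fun x => by simp only [hF.per₂, hG.per₂]⟩

lemma SmoothPer.sub {F G : ℝ × ℝ → ℂ} (hF : SmoothPer F) (hG : SmoothPer G) :
    SmoothPer fun x => F x - G x :=
  ⟨hF.smooth.sub hG.smooth, fun x => by simp only [hF.per₁, hG.per₁],
    fun x => by simp only [hF.per₂, hG.per₂]⟩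

lemma smoothPer_eK (k : ℤ × ℤ) : SmoothPer (eK k) := by
  refine ⟨?_, fun x => ?_, fun x => ?_⟩
  · unfold eK
    refine ContDiff.cexp (contDiff_const.mul ?_)
    exact (contDiff_const.mul (ofRealCLM.contDiff.comp contDiff_fst)).add
      (contDiff_const.mul (ofRealCLM.contDiff.comp contDiff_snd))
  · unfold eK
    refine Eq.trans ?_ (Complex.exp_periodic.int_mul k.1 _)
    congr 1
    push_cast
    ring
  · unfold eK
    refine Eq.trans ?_ (Complex.exp_periodic.int_mul k.2 _)
    congr 1
    push_cast
    ring

lemma dv_eK (v : ℝ × ℝ) (k : ℤ × ℤ) (x : ℝ × ℝ) :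
    dv v (eK k) x = Complex.I * (k.1 * v.1 + k.2 * v.2) * eK k x := by
  have h1 : HasFDerivAt (fun x : ℝ × ℝ => (x.1 : ℂ))
      (ofRealCLM.comp (ContinuousLinearMap.fst ℝ ℝ ℝ)) x :=
    (ofRealCLM.comp (ContinuousLinearMap.fst ℝ ℝ ℝ)).hasFDerivAt
  have h2 : HasFDerivAt (fun x : ℝ × ℝ => (x.2 : ℂ))
      (ofRealCLM.comp (ContinuousLinearMap.snd ℝ ℝ ℝ)) x :=
    (ofRealCLM.comp (ContinuousLinearMap.snd ℝ ℝ ℝ)).hasFDerivAt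
  have h := (((h1.const_mul (k.1 : ℂ)).add (h2.const_mul (k.2 : ℂ))).const_mul Complex.I).cexp
  have h' : HasFDerivAt (eK k) _ x := h
  rw [dv, h'.fderiv]
  simp [eK]
  ring

lemma norm_eK (k : ℤ × ℤ) (x : ℝ × ℝ) : ‖eK k x‖ = 1 := by
  rw [eK, show Complex.I * ((k.1 : ℂ) * (x.1 : ℂ) + (k.2 : ℂ) * (x.2 : ℂ)) =
    ((k.1 * x.1 + k.2 * x.2 : ℝ) : ℂ) * Complex.I by push_cast; ring, Complex.norm_exp_ofReal_mul_I]

lemma eK_add (k l : ℤ × ℤ) (x : ℝ × ℝ) : eK (k + l) x = eK k x * eK l x := by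
  rw [eK, eK, eK, ← Complex.exp_add]
  congr 1
  push_cast [Prod.fst_add, Prod.snd_add]
  ring

lemma conj_eK (k : ℤ × ℤ) (x : ℝ × ℝ) : (starRingEnd ℂ) (eK k x) = eK (-k) x := by
  rw [eK, eK, ← Complex.exp_conj]
  congr 1
  simp
  ring

lemma fcC_eq (F : ℝ × ℝ → ℂ) (k : ℤ × ℤ) :
    fcC F k = (1 / (2 * π) ^ 2 : ℂ) * ∫ x in Q2, F x * eK (-k) x := by
  rw [fcC]
  congr 2
  ext x
  rw [eK]
  congr 2
  push_cast [Prod.fst_neg, Prod.snd_neg]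
  ring

lemma setIntegral_Q2_mul_eK (F : ℝ × ℝ → ℂ) (k : ℤ × ℤ) :
    ∫ x in Q2, F x * eK k x = (2 * π) ^ 2 * fcC F (-k) := by
  have : (π : ℂ) ≠ 0 := by exact_mod_cast Real.pi_ne_zero
  rw [fcC_eq, neg_neg]
  field_simp

lemma measurableSet_Q2 : MeasurableSet Q2 := measurableSet_Ioc.prod measurableSet_Ioc

lemma integrableOn_Q2 {F : ℝ × ℝ → ℂ} (hF : Continuous F) : IntegrableOn F Q2 :=
  (hF.continuousOn.integrableOn_compact (isCompact_Icc.prod isCompact_Icc)).mono_set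
    (Set.prod_mono (Ioc_subset_Icc_self (a := 0) (b := 2 * π))
      (Ioc_subset_Icc_self (a := 0) (b := 2 * π)))

lemma integrableOn_Q2_mul_eK {F : ℝ × ℝ → ℂ} (hF : Continuous F) (k : ℤ × ℤ) :
    IntegrableOn (fun x => F x * eK k x) Q2 :=
  integrableOn_Q2 (hF.mul (smoothPer_eK k).continuous)

lemma setIntegral_Q2 {F : ℝ × ℝ → ℂ} (hF : Continuous F) :
    ∫ x in Q2, F x = ∫ x₁ in (0)..(2 * π), ∫ x₂ in (0)..(2 * π), F (x₁, x₂) := by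
  have h := integrableOn_Q2 hF
  simp only [intervalIntegral.integral_of_le Real.two_pi_pos.le]
  exact setIntegral_prod F h

lemma setIntegral_Q2_symm {F : ℝ × ℝ → ℂ} (hF : Continuous F) :
    ∫ x in Q2, F x = ∫ x₂ in (0)..(2 * π), ∫ x₁ in (0)..(2 * π), F (x₁, x₂) := by
  have h := integrableOn_Q2 hF
  simp only [intervalIntegral.integral_of_le Real.two_pi_pos.le]
  rw [IntegrableOn, Q2, Measure.volume_eq_prod, ← Measure.prod_restrict] at h
  rw [Q2, Measure.volume_eq_prod, ← Measure.prod_restrict, integral_prod_symm _ h]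
  rfl

lemma SmoothPer.integral_dv {F : ℝ × ℝ → ℂ} (hF : SmoothPer F) {v : ℝ × ℝ}
    (hv : v = (1, 0) ∨ v = (0, 1)) : ∫ x in Q2, Aniso.dv v F x = 0 := by
  have hc : ∀ v, Continuous (Aniso.dv v F) := fun v => (hF.dv v).continuous
  rcases hv with rfl | rfl
  · rw [setIntegral_Q2_symm (hc _)]
    refine (intervalIntegral.integral_congr fun x₂ _ => ?_).trans
      (intervalIntegral.integral_zero (a := 0) (b := 2 * π))
    have hd : ∀ x₁ ∈ uIcc 0 (2 * π), HasDerivAt (fun t => F (t, x₂))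
        (Aniso.dv (1, 0) F (x₁, x₂)) x₁ := fun x₁ _ =>
      (hF.differentiable (x₁, x₂)).hasFDerivAt.comp_hasDerivAt x₁
        ((hasDerivAt_id x₁).prodMk (hasDerivAt_const x₁ x₂))
    rw [intervalIntegral.integral_eq_sub_of_hasDerivAt hd
      (((hc _).comp (by fun_prop : Continuous fun t : ℝ => (t, x₂))).intervalIntegrable _ _)]
    have := hF.per₁ (0, x₂)
    simp only [zero_add] at this
    rw [this, sub_self]
  · rw [setIntegral_Q2 (hc _)]
    refine (intervalIntegral.integral_congr fun x₁ _ => ?_).trans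
      (intervalIntegral.integral_zero (a := 0) (b := 2 * π))
    have hd : ∀ x₂ ∈ uIcc 0 (2 * π), HasDerivAt (fun t => F (x₁, t))
        (Aniso.dv (0, 1) F (x₁, x₂)) x₂ := fun x₂ _ =>
      (hF.differentiable (x₁, x₂)).hasFDerivAt.comp_hasDerivAt x₂
        ((hasDerivAt_const x₂ x₁).prodMk (hasDerivAt_id x₂))
    rw [intervalIntegral.integral_eq_sub_of_hasDerivAt hd
      (((hc _).comp (by fun_prop : Continuous fun t : ℝ => (x₁, t))).intervalIntegrable _ _)]
    have := hF.per₂ (x₁, 0)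
    simp only [zero_add] at this
    rw [this, sub_self]

lemma SmoothPer.fcC_dv {F : ℝ × ℝ → ℂ} (hF : SmoothPer F) {v : ℝ × ℝ}
    (hv : v = (1, 0) ∨ v = (0, 1)) (k : ℤ × ℤ) :
    fcC (Aniso.dv v F) k = Complex.I * (k.1 * v.1 + k.2 * v.2) * fcC F k := by
  have h := (hF.mul (smoothPer_eK (-k))).integral_dv hv
  have hd : ∀ x, Aniso.dv v (fun x => F x * eK (-k) x) x = Aniso.dv v F x * eK (-k) x -
      Complex.I * (k.1 * v.1 + k.2 * v.2) * (F x * eK (-k) x) := fun x => by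
    have e := dv_eK v (-k) x
    rw [Aniso.dv, fderiv_fun_mul (hF.differentiable x) ((smoothPer_eK _).differentiable x)]
    simp only [Aniso.dv] at e ⊢
    simp only [add_apply, smul_apply, smul_eq_mul, e]
    push_cast [Prod.fst_neg, Prod.snd_neg]
    ring
  simp only [hd] at h
  rw [integral_sub (integrableOn_Q2_mul_eK (hF.dv v).continuous _)
    ((integrableOn_Q2_mul_eK hF.continuous _).const_mul _), integral_const_mul] at h
  rw [fcC_eq, fcC_eq, sub_eq_zero.1 h]
  ring

lemma fcC_sub {F G : ℝ × ℝ → ℂ} (hF : Continuous F) (hG : Continuous G) (k : ℤ × ℤ) :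
    fcC (fun x => F x - G x) k = fcC F k - fcC G k := by
  simp only [fcC_eq, sub_mul]
  rw [integral_sub (integrableOn_Q2_mul_eK hF _) (integrableOn_Q2_mul_eK hG _), mul_sub]

lemma fcC_add {F G : ℝ × ℝ → ℂ} (hF : Continuous F) (hG : Continuous G) (k : ℤ × ℤ) :
    fcC (fun x => F x + G x) k = fcC F k + fcC G k := by
  simp only [fcC_eq, add_mul]
  rw [integral_add (integrableOn_Q2_mul_eK hF _) (integrableOn_Q2_mul_eK hG _), mul_add]

lemma exists_norm_fcC_le (F : ℝ × ℝ → ℂ) : ∃ M : ℝ, ∀ k, ‖fcC F k‖ ≤ M := by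
  refine ⟨‖(1 / (2 * π) ^ 2 : ℂ)‖ * ∫ x in Q2, ‖F x‖, fun k => ?_⟩
  rw [fcC_eq, norm_mul]
  gcongr
  refine (norm_integral_le_integral_norm _).trans_eq ?_
  simp only [norm_mul, norm_eK, mul_one]

lemma SmoothPer.exists_decay (p : ℕ) {F : ℝ × ℝ → ℂ} (hF : SmoothPer F) : ∃ M : ℝ, ∀ k : ℤ × ℤ,
    ((1 + (k.1 : ℝ) ^ 2) * (1 + (k.2 : ℝ) ^ 2)) ^ p * ‖fcC F k‖ ≤ M := by
  induction p generalizing F with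
  | zero => simpa using exists_norm_fcC_le F
  | succ p ih =>
    have hG := hF.sub ((hF.dv (1, 0)).dv (1, 0))
    obtain ⟨M, hM⟩ := ih (hG.sub ((hG.dv (0, 1)).dv (0, 1)))
    refine ⟨M, fun k => ?_⟩
    refine le_trans (le_of_eq ?_) (hM k)
    rw [fcC_sub hG.continuous ((hG.dv _).dv _).continuous, (hG.dv _).fcC_dv (Or.inr rfl),
      hG.fcC_dv (Or.inr rfl), fcC_sub hF.continuous ((hF.dv _).dv _).continuous,
      (hF.dv _).fcC_dv (Or.inl rfl), hF.fcC_dv (Or.inl rfl)]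
    have e : fcC F k - Complex.I * (k.1 * ((1 : ℝ) : ℂ) + k.2 * ((0 : ℝ) : ℂ)) *
        (Complex.I * (k.1 * ((1 : ℝ) : ℂ) + k.2 * ((0 : ℝ) : ℂ)) * fcC F k) =
        ((1 + (k.1 : ℝ) ^ 2 : ℝ) : ℂ) * fcC F k := by
      push_cast
      linear_combination (-(k.1 : ℂ) ^ 2 * fcC F k) * Complex.I_sq
    simp only [e]
    have e' : ((1 + (k.1 : ℝ) ^ 2 : ℝ) : ℂ) * fcC F k -
        Complex.I * (k.1 * ((0 : ℝ) : ℂ) + k.2 * ((1 : ℝ) : ℂ)) *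
        (Complex.I * (k.1 * ((0 : ℝ) : ℂ) + k.2 * ((1 : ℝ) : ℂ)) *
          (((1 + (k.1 : ℝ) ^ 2 : ℝ) : ℂ) * fcC F k)) =
        (((1 + (k.1 : ℝ) ^ 2) * (1 + (k.2 : ℝ) ^ 2) : ℝ) : ℂ) * fcC F k := by
      push_cast
      linear_combination (-(k.2 : ℂ) ^ 2 * (1 + (k.1 : ℂ) ^ 2) * fcC F k) * Complex.I_sq
    rw [e', norm_mul, Complex.norm_real, Real.norm_of_nonneg (by positivity), pow_succ]
    ring

lemma summable_one_add_sq_inv : Summable fun n : ℤ => (1 + (n : ℝ) ^ 2)⁻¹ := by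
  have h := Real.summable_one_div_int_pow.2 (by norm_num : 1 < 2)
  have h0 : Summable fun n : ℤ => if n = 0 then (1 : ℝ) else 0 :=
    summable_of_ne_finset_zero (s := {0}) fun b hb => by simp at hb; simp [hb]
  refine Summable.of_nonneg_of_le (fun n => by positivity) (fun n => ?_) (h.add h0)
  by_cases hn : n = 0
  · subst hn; simp
  · have hn' : 0 < (n : ℝ) ^ 2 := by positivity
    rw [if_neg hn, add_zero, one_div]
    exact inv_anti₀ hn' (by linarith)

/-- Fourier coefficients of a smooth function are summable against any polynomial weight. -/
lemma SmoothPer.summable {F : ℝ × ℝ → ℂ} (hF : SmoothPer F) (p : ℕ) :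
    Summable fun k : ℤ × ℤ => ((1 + (k.1 : ℝ) ^ 2) * (1 + (k.2 : ℝ) ^ 2)) ^ p * ‖fcC F k‖ := by
  obtain ⟨M, hM⟩ := hF.exists_decay (p + 1)
  have h := (summable_one_add_sq_inv.mul_of_nonneg summable_one_add_sq_inv
    (fun n => by positivity) (fun n => by positivity)).mul_left M
  refine Summable.of_nonneg_of_le (fun k => by positivity) (fun k => ?_) h
  have hk : 0 < (1 + (k.1 : ℝ) ^ 2) * (1 + (k.2 : ℝ) ^ 2) := by positivity
  rw [← mul_inv, ← div_eq_mul_inv, le_div_iff₀ hk]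
  refine le_trans (le_of_eq ?_) (hM k)
  ring

lemma SmoothPer.summable_norm_fcC {F : ℝ × ℝ → ℂ} (hF : SmoothPer F) :
    Summable fun k => ‖fcC F k‖ := by
  simpa using hF.summable 0

/-- Pointwise inversion of an absolutely convergent Fourier series on the circle. -/
lemma hasSum_fc1 {g : ℝ → ℂ} (hg : Continuous g) (h0 : g 0 = g (2 * π))
    (hs : Summable fun n => ‖fc1 g n‖) {x : ℝ} (hx : x ∈ I2pi) :
    HasSum (fun n : ℤ => fc1 g n * Complex.exp (Complex.I * (n * x))) (g x) := by
  have : Fact (0 < 2 * π) := ⟨Real.two_pi_pos⟩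
  have h0' : g 0 = g (0 + 2 * π) := by rw [zero_add, h0]
  let G : C(AddCircle (2 * π), ℂ) := ⟨AddCircle.liftIoc (2 * π) 0 g,
    AddCircle.liftIoc_continuous h0' hg.continuousOn⟩
  have hG : ∀ y ∈ I2pi, G (y : AddCircle (2 * π)) = g y := fun y hy =>
    AddCircle.liftIoc_coe_apply (by rw [zero_add]; exact hy)
  have hc : ∀ n, fourierCoeff G n = fc1 g n := fun n => by
    rw [fourierCoeff_eq_intervalIntegral _ n 0, fc1, zero_add,
      intervalIntegral.integral_of_le Real.two_pi_pos.le, real_smul]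
    congr 1
    · push_cast; rfl
    · refine setIntegral_congr_fun measurableSet_Ioc fun y hy => ?_
      simp only [hG y hy, fourier_coe_apply, smul_eq_mul]
      rw [mul_comm]
      congr 2
      have : (π : ℂ) ≠ 0 := by exact_mod_cast Real.pi_ne_zero
      push_cast
      field_simp
  have h := has_pointwise_sum_fourier_series_of_summable (f := G)
    (by simpa only [funext hc] using hs.of_norm) (x : AddCircle (2 * π))
  rw [hG x hx] at h
  convert h using 1
  ext n
  rw [hc, fourier_coe_apply, smul_eq_mul]
  congr 2
  have : (π : ℂ) ≠ 0 := by exact_mod_cast Real.pi_ne_zero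
  push_cast
  field_simp

lemma fcC_eq_fc1 {F : ℝ × ℝ → ℂ} (hF : Continuous F) (n m : ℤ) :
    fcC F (n, m) = fc1 (fun y => fc1 (fun x => F (x, y)) n) m := by
  have h := setIntegral_Q2_symm (hF.mul (smoothPer_eK (-(n, m))).continuous)
  simp only [intervalIntegral.integral_of_le Real.two_pi_pos.le, Pi.mul_apply] at h
  have e : ∀ y : ℝ, fc1 (fun x => F (x, y)) n * Complex.exp (-Complex.I * (m * y)) =
      (1 / (2 * π) : ℂ) * ∫ x in Ioc 0 (2 * π), F (x, y) * eK (-(n, m)) (x, y) := fun y => by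
    rw [fc1, mul_assoc, ← integral_mul_const]
    congr 1
    refine setIntegral_congr_fun measurableSet_Ioc fun x _ => ?_
    simp only [mul_assoc, ← Complex.exp_add, eK]
    congr 2
    simp
    ring
  rw [fcC_eq, fc1]
  simp only [e]
  rw [integral_const_mul, I2pi, ← h]
  ring

lemma SmoothPer.summable_fcC_mul_eK {F : ℝ × ℝ → ℂ} (hF : SmoothPer F) (x : ℝ × ℝ) :
    Summable fun k => fcC F k * eK k x :=
  Summable.of_norm (by simpa only [norm_mul, norm_eK, mul_one] using hF.summable_norm_fcC)

/-- Fourier inversion for smooth functions on the torus. -/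
lemma SmoothPer.hasSum_fcC {F : ℝ × ℝ → ℂ} (hF : SmoothPer F) {x : ℝ × ℝ} (hx : x ∈ Q2) :
    HasSum (fun k => fcC F k * eK k x) (F x) := by
  obtain ⟨x, y⟩ := x
  obtain ⟨hx, hy⟩ : x ∈ I2pi ∧ y ∈ I2pi := hx
  have hcont : ∀ n, Continuous fun y => fc1 (fun x => F (x, y)) n := fun n => by
    simp only [fc1, I2pi, ← intervalIntegral.integral_of_le Real.two_pi_pos.le]
    refine continuous_const.mul
      (intervalIntegral.continuous_parametric_intervalIntegral_of_continuous' ?_ _ _)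
    have := hF.continuous
    unfold Function.uncurry
    fun_prop
  have hs := hF.summable_norm_fcC
  have hsn : ∀ n, Summable fun m => ‖fcC F (n, m)‖ := fun n => hs.prod_factor n
  have hv : ∀ n, HasSum (fun m : ℤ => fcC F (n, m) * Complex.exp (Complex.I * (m * y)))
      (fc1 (fun x => F (x, y)) n) := fun n => by
    have := hasSum_fc1 (hcont n) (by
      have : ∀ t, F (t, 2 * π) = F (t, 0) := fun t => by simpa using hF.per₂ (t, 0)
      simp only [this]) (by simpa only [← fcC_eq_fc1 hF.continuous] using hsn n) hy
    simpa only [← fcC_eq_fc1 hF.continuous] using this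
  have hle : ∀ n, ‖fc1 (fun x => F (x, y)) n‖ ≤ ∑' m, ‖fcC F (n, m)‖ := fun n => by
    have he : ∀ m : ℤ, ‖fcC F (n, m) * Complex.exp (Complex.I * (m * y))‖ = ‖fcC F (n, m)‖ :=
      fun m => by
        rw [norm_mul, show Complex.I * ((m : ℂ) * y) = ((m * y : ℝ) : ℂ) * Complex.I by
          push_cast; ring, Complex.norm_exp_ofReal_mul_I, mul_one]
    rw [← (hv n).tsum_eq]
    exact (norm_tsum_le_tsum_norm (by simpa only [he] using hsn n)).trans_eq (by simp only [he])
  have hh := hasSum_fc1 (g := fun x => F (x, y)) (hF.continuous.comp (by fun_prop))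
    (by simpa using (hF.per₁ (0, y)).symm)
    (Summable.of_nonneg_of_le (fun _ => norm_nonneg _) hle hs.prod) hx
  have hsum := hF.summable_fcC_mul_eK (x, y)
  have hfib : ∀ n, HasSum (fun m => fcC F (n, m) * eK (n, m) (x, y))
      (fc1 (fun x => F (x, y)) n * Complex.exp (Complex.I * (n * x))) := fun n => by
    have e : ∀ m : ℤ, fcC F (n, m) * eK (n, m) (x, y) =
        fcC F (n, m) * Complex.exp (Complex.I * (m * y)) * Complex.exp (Complex.I * (n * x)) :=
      fun m => by
        rw [mul_assoc, ← Complex.exp_add, eK]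
        congr 2
        ring
    simpa only [e] using (hv n).mul_right (Complex.exp (Complex.I * (n * x)))
  rw [← (hsum.hasSum.prod_fiberwise hfib).unique hh]
  exact hsum.hasSum

/-- Pairing an absolutely convergent Fourier series with a continuous function. -/
lemma setIntegral_Q2_tsum_mul {a : ℤ × ℤ → ℂ} (ha : Summable fun k => ‖a k‖) {h : ℝ × ℝ → ℂ}
    (hh : Continuous h) :
    HasSum (fun k => a k * ((2 * π) ^ 2 * fcC h (-k))) (∫ x in Q2, (∑' k, a k * eK k x) * h x) := by
  have hint : ∀ k, IntegrableOn (fun x => a k * (h x * eK k x)) Q2 := fun k =>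
    (integrableOn_Q2_mul_eK hh k).const_mul _
  have hn : Summable fun k => ∫ x in Q2, ‖a k * (h x * eK k x)‖ := by
    simp only [norm_mul, norm_eK, mul_one, integral_const_mul]
    exact ha.mul_right _
  have := hasSum_integral_of_summable_integral_norm hint hn
  simp only [integral_const_mul, setIntegral_Q2_mul_eK] at this
  have e : ∀ x, (∑' k, a k * eK k x) * h x = ∑' k, a k * (h x * eK k x) := fun x => by
    rw [← tsum_mul_right]
    exact tsum_congr fun k => by ring
  simpa only [e] using this

/-- The Fourier coefficients of a product. -/
lemma SmoothPer.hasSum_fcC_mul {F G : ℝ × ℝ → ℂ} (hF : SmoothPer F) (hG : SmoothPer G)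
    (k : ℤ × ℤ) : HasSum (fun n => fcC F (k - n) * fcC G n) (fcC (fun x => F x * G x) k) := by
  have hpi : (π : ℂ) ≠ 0 := by exact_mod_cast Real.pi_ne_zero
  have h := (setIntegral_Q2_tsum_mul hG.summable_norm_fcC
    (hF.continuous.mul (smoothPer_eK (-k)).continuous)).mul_left (1 / (2 * π) ^ 2 : ℂ)
  have e : ∀ n, fcC (F * eK (-k)) (-n) = fcC F (k - n) := fun n => by
    rw [fcC_eq, fcC_eq]
    congr 2
    ext x
    rw [Pi.mul_apply, mul_assoc, ← eK_add]
    congr 2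
    abel
  have e₁ : ∀ n, fcC F (k - n) * fcC G n =
      1 / (2 * π) ^ 2 * (fcC G n * ((2 * π) ^ 2 * fcC (F * eK (-k)) (-n))) := fun n => by
    rw [e]
    field_simp
  have e₂ : fcC (fun x => F x * G x) k =
      1 / (2 * π) ^ 2 * ∫ x in Q2, (∑' k, fcC G k * eK k x) * (F * eK (-k)) x := by
    rw [fcC_eq]
    congr 1
    refine setIntegral_congr_fun measurableSet_Q2 fun x hx => ?_
    simp only [(hG.hasSum_fcC hx).tsum_eq, Pi.mul_apply]
    ring
  rw [e₂, funext e₁]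
  exact h

lemma fcC_eK (l k : ℤ × ℤ) : fcC (eK l) k = if k = l then 1 else 0 := by
  have hpi : (π : ℂ) ≠ 0 := by exact_mod_cast Real.pi_ne_zero
  split_ifs with h
  · rw [fcC_eq]
    have : ∀ x, eK l x * eK (-k) x = 1 := fun x => by
      rw [← eK_add, h, add_neg_cancel]
      simp [eK]
    simp only [this]
    rw [setIntegral_Q2 continuous_const]
    simp
    field_simp
  · by_contra h0
    have key : ∀ v : ℝ × ℝ, v = (1, 0) ∨ v = (0, 1) →
        (l.1 * v.1 + l.2 * v.2 : ℂ) = k.1 * v.1 + k.2 * v.2 := fun v hv => by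
      have h1 := (smoothPer_eK l).fcC_dv hv k
      rw [funext (dv_eK v l)] at h1
      have h2 : fcC (fun x => Complex.I * (l.1 * v.1 + l.2 * v.2) * eK l x) k =
          Complex.I * (l.1 * v.1 + l.2 * v.2) * fcC (eK l) k := by
        simp only [fcC_eq, mul_assoc, integral_const_mul]
        ring
      rw [h2] at h1
      exact mul_left_cancel₀ Complex.I_ne_zero (mul_right_cancel₀ h0 h1)
    have h1 := key _ (Or.inl rfl)
    have h2 := key _ (Or.inr rfl)
    simp at h1 h2
    exact h (Prod.ext h1.symm h2.symm)

lemma fcC_tsum {a : ℤ × ℤ → ℂ} (ha : Summable fun k => ‖a k‖) (k : ℤ × ℤ) :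
    fcC (fun x => ∑' l, a l * eK l x) k = a k := by
  have hpi : (π : ℂ) ≠ 0 := by exact_mod_cast Real.pi_ne_zero
  have h := setIntegral_Q2_tsum_mul ha (smoothPer_eK (-k)).continuous
  simp only [fcC_eK, neg_inj] at h
  rw [fcC_eq, ← h.tsum_eq, tsum_eq_single k fun l hl => by simp [hl]]
  simp
  field_simp

lemma continuous_tsum_eK {a : ℤ × ℤ → ℂ} (ha : Summable fun k => ‖a k‖) :
    Continuous fun x => ∑' l, a l * eK l x :=
  continuous_tsum (fun l => continuous_const.mul (smoothPer_eK l).continuous) ha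
    fun l x => by rw [norm_mul, norm_eK, mul_one]

/-- Parseval's identity for absolutely convergent Fourier series. -/
lemma hasSum_parseval {a b : ℤ × ℤ → ℂ} (ha : Summable fun k => ‖a k‖)
    (hb : Summable fun k => ‖b k‖) :
    HasSum (fun k => (2 * π) ^ 2 * (a k * (starRingEnd ℂ) (b k)))
      (∫ x in Q2, (∑' k, a k * eK k x) * (starRingEnd ℂ) (∑' k, b k * eK k x)) := by
  have h := setIntegral_Q2_tsum_mul ha (Complex.continuous_conj.comp (continuous_tsum_eK hb))
  have e : ∀ k, fcC (⇑(starRingEnd ℂ) ∘ fun x => ∑' l, b l * eK l x) (-k) =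
      (starRingEnd ℂ) (b k) := fun k => by
    rw [← fcC_tsum hb k, fcC_eq, fcC_eq, map_mul, ← integral_conj]
    congr 1
    · simp [map_ofNat (starRingEnd ℂ) 2]
    · congr 1
      ext x
      simp [conj_eK]
  simp only [e] at h
  refine (funext fun k => ?_ : (fun k => (2 * π : ℂ) ^ 2 * (a k * (starRingEnd ℂ) (b k))) =
    fun k => a k * ((2 * π) ^ 2 * (starRingEnd ℂ) (b k))) ▸ h
  ring

lemma smoothPer_ofReal {f : ℝ × ℝ → ℝ} (hf : Smooth f) (hp : Per f) :
    SmoothPer fun x => (f x : ℂ) :=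
  ⟨ofRealCLM.contDiff.comp hf, fun x => by rw [hp.1], fun x => by rw [hp.2]⟩

lemma dv_ofReal {f : ℝ × ℝ → ℝ} (hf : Smooth f) (v : ℝ × ℝ) :
    dv v (fun x => (f x : ℂ)) = fun x => ((fderiv ℝ f x v : ℝ) : ℂ) := by
  ext x
  have h : HasFDerivAt f (fderiv ℝ f x) x := (hf.differentiable (by simp) x).hasFDerivAt
  have h' : HasFDerivAt (fun x => (f x : ℂ)) (ofRealCLM.comp (fderiv ℝ f x)) x :=
    ofRealCLM.hasFDerivAt.comp x h
  rw [dv, h'.fderiv]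
  rfl

lemma smoothPer_fderiv {f : ℝ × ℝ → ℝ} (hf : Smooth f) (hp : Per f) (v : ℝ × ℝ) :
    SmoothPer fun x => ((fderiv ℝ f x v : ℝ) : ℂ) :=
  dv_ofReal hf v ▸ (smoothPer_ofReal hf hp).dv v

lemma fc_pd1 {f : ℝ × ℝ → ℝ} (hf : Smooth f) (hp : Per f) (k : ℤ × ℤ) :
    fc (pd1 f) k = Complex.I * k.1 * fc f k := by
  have h := (smoothPer_ofReal hf hp).fcC_dv (Or.inl rfl) k
  rw [dv_ofReal hf] at h
  simpa [fc, pd1] using h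

lemma fc_pd2 {f : ℝ × ℝ → ℝ} (hf : Smooth f) (hp : Per f) (k : ℤ × ℤ) :
    fc (pd2 f) k = Complex.I * k.2 * fc f k := by
  have h := (smoothPer_ofReal hf hp).fcC_dv (Or.inr rfl) k
  rw [dv_ofReal hf] at h
  simpa [fc, pd2] using h

lemma fc_neg (f : ℝ × ℝ → ℝ) (k : ℤ × ℤ) : fc f (-k) = (starRingEnd ℂ) (fc f k) := by
  rw [fc, fc, fcC_eq, fcC_eq, map_mul, ← integral_conj]
  congr 1
  · simp [map_ofNat (starRingEnd ℂ) 2]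
  · congr 1
    ext x
    simp [conj_eK]

lemma SmoothV.comp1 {u : ℝ × ℝ → ℝ × ℝ} (hu : SmoothV u) : Smooth (comp1 u) :=
  contDiff_fst.comp hu

lemma SmoothV.comp2 {u : ℝ × ℝ → ℝ × ℝ} (hu : SmoothV u) : Smooth (comp2 u) :=
  contDiff_snd.comp hu

/-- The divergence-free condition on the Fourier side. -/
lemma DivFree.fc_eq {u : ℝ × ℝ → ℝ × ℝ} (hd : DivFree u) (hu : SmoothV u) (hp : PerV u)
    (k : ℤ × ℤ) : k.1 * fc (comp1 u) k + k.2 * fc (comp2 u) k = 0 := by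
  have h : fcC (fun x => (pd1 (comp1 u) x : ℂ) + (pd2 (comp2 u) x : ℂ)) k = 0 := by
    have e : ∀ x, (pd1 (comp1 u) x : ℂ) + (pd2 (comp2 u) x : ℂ) = 0 := fun x => by
      rw [← Complex.ofReal_add, hd x, Complex.ofReal_zero]
    simp only [e, fcC, zero_mul, integral_zero, mul_zero]
  have h1 := fc_pd1 hu.comp1 hp.1 k
  have h2 := fc_pd2 hu.comp2 hp.2 k
  rw [fc] at h1 h2
  have h12 := fcC_add (smoothPer_fderiv hu.comp1 hp.1 (1, 0)).continuous
    (smoothPer_fderiv hu.comp2 hp.2 (0, 1)).continuous k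
  simp only [pd1, pd2] at h h1 h2
  rw [h12, h1, h2] at h
  refine mul_left_cancel₀ Complex.I_ne_zero ?_
  linear_combination h

lemma smoothPer_transport {u : ℝ × ℝ → ℝ × ℝ} (hu : SmoothV u) (hpu : PerV u) {f : ℝ × ℝ → ℝ}
    (hf : Smooth f) (hpf : Per f) :
    SmoothPer fun x => (((u x).1 * pd1 f x + (u x).2 * pd2 f x : ℝ) : ℂ) := by
  have h := ((smoothPer_ofReal hu.comp1 hpu.1).mul (smoothPer_fderiv hf hpf (1, 0))).add
    ((smoothPer_ofReal hu.comp2 hpu.2).mul (smoothPer_fderiv hf hpf (0, 1)))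
  simp only [Complex.ofReal_add, Complex.ofReal_mul]
  exact h

/-- The Fourier coefficients of the transport term. -/
lemma hasSum_fc_transport {u : ℝ × ℝ → ℝ × ℝ} (hu : SmoothV u) (hpu : PerV u) {f : ℝ × ℝ → ℝ}
    (hf : Smooth f) (hpf : Per f) (k : ℤ × ℤ) :
    HasSum (fun n : ℤ × ℤ => Complex.I *
        (fc (comp1 u) (k - n) * n.1 + fc (comp2 u) (k - n) * n.2) * fc f n)
      (fc (fun x => (u x).1 * pd1 f x + (u x).2 * pd2 f x) k) := by
  have hu1 := smoothPer_ofReal hu.comp1 hpu.1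
  have hu2 := smoothPer_ofReal hu.comp2 hpu.2
  have hf1 := smoothPer_fderiv hf hpf (1, 0)
  have hf2 := smoothPer_fderiv hf hpf (0, 1)
  have h := (hu1.hasSum_fcC_mul hf1 k).add (hu2.hasSum_fcC_mul hf2 k)
  rw [← fcC_add (hu1.mul hf1).continuous (hu2.mul hf2).continuous] at h
  have e : ∀ n : ℤ × ℤ, Complex.I *
        (fc (comp1 u) (k - n) * n.1 + fc (comp2 u) (k - n) * n.2) * fc f n =
      fcC (fun x => (comp1 u x : ℂ)) (k - n) * fcC (fun x => ((fderiv ℝ f x (1, 0) : ℝ) : ℂ)) n +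
      fcC (fun x => (comp2 u x : ℂ)) (k - n) * fcC (fun x => ((fderiv ℝ f x (0, 1) : ℝ) : ℂ)) n :=
    fun n => by
      have h1 := fc_pd1 hf hpf n
      have h2 := fc_pd2 hf hpf n
      simp only [fc, pd1, pd2] at h1 h2 ⊢
      rw [h1, h2]
      ring
  rw [funext e, fc]
  simp only [Complex.ofReal_add, Complex.ofReal_mul]
  exact h

/-- Parseval's identity for the blocks. -/
lemma hasSum_ipCV {φ : ℤ × ℤ → ℝ} {M : ℝ} (hM : ∀ k, φ k ^ 2 ≤ M) {F₁ F₂ G₁ G₂ : ℝ × ℝ → ℂ}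
    (hF₁ : SmoothPer F₁) (hF₂ : SmoothPer F₂) (hG₁ : SmoothPer G₁) (hG₂ : SmoothPer G₂) :
    HasSum (fun k => (2 * π) ^ 2 * ((φ k : ℂ) ^ 2 * (fcC F₁ k * (starRingEnd ℂ) (fcC G₁ k) +
        fcC F₂ k * (starRingEnd ℂ) (fcC G₂ k))))
      (ipCV (fun x => (∑' k, φ k * fcC F₁ k * eK k x, ∑' k, φ k * fcC F₂ k * eK k x))
        (fun x => (∑' k, φ k * fcC G₁ k * eK k x, ∑' k, φ k * fcC G₂ k * eK k x))) := by
  have hs : ∀ {F : ℝ × ℝ → ℂ}, SmoothPer F → Summable fun k => ‖(φ k : ℂ) * fcC F k‖ := by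
    intro F hF
    refine Summable.of_nonneg_of_le (fun _ => norm_nonneg _) (fun k => ?_)
      (hF.summable_norm_fcC.mul_left √M)
    rw [norm_mul, Complex.norm_real, Real.norm_eq_abs]
    gcongr
    exact Real.abs_le_sqrt (hM k)
  have hc : ∀ {F : ℝ × ℝ → ℂ}, SmoothPer F → Continuous fun x => ∑' k, φ k * fcC F k * eK k x :=
    fun hF => continuous_tsum_eK (hs hF)
  have h := (hasSum_parseval (hs hF₁) (hs hG₁)).add (hasSum_parseval (hs hF₂) (hs hG₂))
  have hadd := integral_add
    (integrableOn_Q2 ((hc hF₁).mul (Complex.continuous_conj.comp (hc hG₁))))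
    (integrableOn_Q2 ((hc hF₂).mul (Complex.continuous_conj.comp (hc hG₂))))
  simp only [Pi.mul_apply, Function.comp_apply] at hadd
  rw [← hadd] at h
  rw [ipCV]
  have e : ∀ k, (2 * π) ^ 2 * ((φ k : ℂ) ^ 2 * (fcC F₁ k * (starRingEnd ℂ) (fcC G₁ k) +
        fcC F₂ k * (starRingEnd ℂ) (fcC G₂ k))) =
      (2 * π) ^ 2 * (φ k * fcC F₁ k * (starRingEnd ℂ) (φ k * fcC G₁ k)) +
        (2 * π) ^ 2 * (φ k * fcC F₂ k * (starRingEnd ℂ) (φ k * fcC G₂ k)) := fun k => by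
    simp only [map_mul, Complex.conj_ofReal]
    ring
  rw [funext e]
  exact h

/-- The size of the Fourier coefficient of a vector field. -/
def amp (u : ℝ × ℝ → ℝ × ℝ) (k : ℤ × ℤ) : ℝ := ‖fc (comp1 u) k‖ + ‖fc (comp2 u) k‖

lemma amp_nonneg (u : ℝ × ℝ → ℝ × ℝ) : 0 ≤ amp u := fun _ => by
  unfold amp
  positivity

lemma amp_neg (u : ℝ × ℝ → ℝ × ℝ) (k : ℤ × ℤ) : amp u (-k) = amp u k := by
  simp only [amp, fc_neg, RCLike.norm_conj]

lemma summable_amp {u : ℝ × ℝ → ℝ × ℝ} (hu : SmoothV u) (hp : PerV u) (p : ℕ) :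
    Summable fun k : ℤ × ℤ => ((1 + (k.1 : ℝ) ^ 2) * (1 + (k.2 : ℝ) ^ 2)) ^ p * amp u k := by
  have h := ((smoothPer_ofReal hu.comp1 hp.1).summable p).add
    ((smoothPer_ofReal hu.comp2 hp.2).summable p)
  simp only [← mul_add] at h
  exact h

/-- The summand of `⟨Δ(u·∇w), Δw⟩` on the Fourier side. -/
def pairTerm (φ : ℝ → ℝ) (u w : ℝ × ℝ → ℝ × ℝ) (p : (ℤ × ℤ) × (ℤ × ℤ)) : ℂ :=
  (φ p.1.2 : ℂ) ^ 2 *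
    (fc (comp1 u) (p.1 - p.2) * p.2.1 + fc (comp2 u) (p.1 - p.2) * p.2.2) *
    (fc (comp1 w) p.2 * (starRingEnd ℂ) (fc (comp1 w) p.1) +
      fc (comp2 w) p.2 * (starRingEnd ℂ) (fc (comp2 w) p.1))

lemma norm_pair_le (w : ℝ × ℝ → ℝ × ℝ) (k n : ℤ × ℤ) :
    ‖fc (comp1 w) n * (starRingEnd ℂ) (fc (comp1 w) k) +
      fc (comp2 w) n * (starRingEnd ℂ) (fc (comp2 w) k)‖ ≤ amp w n * amp w k := by
  refine (norm_add_le _ _).trans ?_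
  simp only [norm_mul, RCLike.norm_conj, amp]
  have h1 := norm_nonneg (fc (comp1 w) n)
  have h2 := norm_nonneg (fc (comp1 w) k)
  have h3 := norm_nonneg (fc (comp2 w) n)
  have h4 := norm_nonneg (fc (comp2 w) k)
  nlinarith [mul_nonneg h1 h4, mul_nonneg h2 h3]

lemma summable_pairTerm {φ : ℝ → ℝ} {M : ℝ} (hM : ∀ z, φ z ^ 2 ≤ M) {u w : ℝ × ℝ → ℝ × ℝ}
    (hw : SmoothV w) (hpw : PerV w) : Summable (pairTerm φ u w) := by
  obtain ⟨M₁, hM₁⟩ := exists_norm_fcC_le fun x => (comp1 u x : ℂ)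
  obtain ⟨M₂, hM₂⟩ := exists_norm_fcC_le fun x => (comp2 u x : ℂ)
  have hM0 : 0 ≤ M := (sq_nonneg _).trans (hM 0)
  have hM₁0 : 0 ≤ M₁ := (norm_nonneg _).trans (hM₁ 0)
  have hM₂0 : 0 ≤ M₂ := (norm_nonneg _).trans (hM₂ 0)
  have h := ((summable_amp hw hpw 0).mul_of_nonneg (summable_amp hw hpw 1)
    (fun k => mul_nonneg (by positivity) (amp_nonneg w k))
    (fun k => mul_nonneg (by positivity) (amp_nonneg w k))).mul_left (M * (M₁ + M₂))
  refine Summable.of_norm_bounded h fun ⟨k, n⟩ => ?_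
  simp only [pairTerm, pow_zero, one_mul, pow_one]
  rw [norm_mul, norm_mul, ← Complex.ofReal_pow, Complex.norm_real,
    Real.norm_of_nonneg (sq_nonneg _)]
  have hw1 := amp_nonneg w k
  have hw2 := amp_nonneg w n
  have habs : ∀ x y : ℝ, |x| ≤ (1 + x ^ 2) * (1 + y ^ 2) := fun x y => by
    have : |x| ≤ 1 + x ^ 2 := by nlinarith [sq_abs x, sq_nonneg (|x| - 1), abs_nonneg x]
    nlinarith [sq_nonneg y, sq_nonneg x, mul_nonneg (sq_nonneg x) (sq_nonneg y)]
  have hb : ‖fc (comp1 u) (k - n) * n.1 + fc (comp2 u) (k - n) * n.2‖ ≤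
      (M₁ + M₂) * ((1 + (n.1 : ℝ) ^ 2) * (1 + (n.2 : ℝ) ^ 2)) := by
    refine (norm_add_le _ _).trans ?_
    rw [add_mul, norm_mul, norm_mul, Complex.norm_intCast, Complex.norm_intCast]
    refine add_le_add (mul_le_mul (hM₁ _) (habs _ _) (abs_nonneg _) hM₁0)
      (mul_le_mul (hM₂ _) ?_ (abs_nonneg _) hM₂0)
    rw [mul_comm (1 + _)]
    exact habs _ _
  calc _ ≤ M * ((M₁ + M₂) * ((1 + (n.1 : ℝ) ^ 2) * (1 + (n.2 : ℝ) ^ 2))) *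
        (amp w n * amp w k) := by
        gcongr
        · exact hM _
        · exact norm_pair_le w k n
    _ = _ := by ring

/-- The block pairing as a double Fourier series. -/
lemma ipCV_eq_tsum {χ θ : ℝ → ℝ} {j : ℤ} {M : ℝ} (hM : ∀ z, blockSymb χ θ j z ^ 2 ≤ M)
    {u w : ℝ × ℝ → ℝ × ℝ} (hu : SmoothV u) (hpu : PerV u) (hw : SmoothV w) (hpw : PerV w) :
    ipCV (LPV χ θ j (advect u w)) (LPV χ θ j w) =
      (2 * π) ^ 2 * Complex.I * ∑' p, pairTerm (blockSymb χ θ j) u w p := by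
  have h1 := hasSum_ipCV (φ := fun k : ℤ × ℤ => blockSymb χ θ j k.2) (fun k => hM k.2)
    (smoothPer_transport hu hpu hw.comp1 hpw.1) (smoothPer_transport hu hpu hw.comp2 hpw.2)
    (smoothPer_ofReal hw.comp1 hpw.1) (smoothPer_ofReal hw.comp2 hpw.2)
  have h2 := ((summable_pairTerm (u := u) hM hw hpw).mul_left
    ((2 * π) ^ 2 * Complex.I)).hasSum
  rw [← tsum_mul_left]
  refine h1.unique (h2.prod_fiberwise fun k => ?_)
  have h3 := (((hasSum_fc_transport hu hpu hw.comp1 hpw.1 k).mul_right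
    ((starRingEnd ℂ) (fc (comp1 w) k))).add ((hasSum_fc_transport hu hpu hw.comp2 hpw.2 k).mul_right
    ((starRingEnd ℂ) (fc (comp2 w) k)))).mul_left ((2 * π) ^ 2 * (blockSymb χ θ j k.2 : ℂ) ^ 2)
  rw [mul_assoc] at h3
  refine Eq.mp (congrArg₂ HasSum (funext fun n => ?_) rfl) h3
  simp only [pairTerm]
  ring

lemma two_mul_tsum_pairTerm {φ : ℝ → ℝ} {M : ℝ} (hM : ∀ z, φ z ^ 2 ≤ M)
    {u w : ℝ × ℝ → ℝ × ℝ} (hw : SmoothV w) (hpw : PerV w) :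
    2 * ∑' p, pairTerm φ u w p = ∑' p, (pairTerm φ u w p + pairTerm φ u w (-p.2, -p.1)) := by
  have hs := summable_pairTerm (u := u) hM hw hpw
  have hinv : Function.Involutive fun p : (ℤ × ℤ) × (ℤ × ℤ) => (-p.2, -p.1) := fun p => by simp
  have h := hinv.toPerm.tsum_eq (pairTerm φ u w)
  have hs' : Summable fun p : (ℤ × ℤ) × (ℤ × ℤ) => pairTerm φ u w (-p.2, -p.1) :=
    hinv.toPerm.summable_iff.2 hs
  rw [hs.tsum_add hs', two_mul]
  exact congrArg _ h.symm

/-- The non-negative majorant of the symmetrised summand. -/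
def majTerm (D : ℝ → ℝ) (u w : ℝ × ℝ → ℝ × ℝ) (k n : ℤ × ℤ) : ℝ :=
  D k.2 * (amp u (k - n) * (|(n.1 : ℝ)| + |((k - n).1 : ℝ)|) * (amp w n * amp w k))

lemma norm_symmetrised_le {φ D : ℝ → ℝ} {C : ℝ} (hC : 0 ≤ C) (hD : 0 ≤ D)
    (heven : ∀ z, φ (-z) = φ z) (h₁ : ∀ z, φ z ^ 2 ≤ C * D z)
    (h₂ : ∀ y z, |φ y ^ 2 * z - φ z ^ 2 * y| ≤ C * |y - z| * (D y + D z))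
    {u : ℝ × ℝ → ℝ × ℝ} (hu : SmoothV u) (hpu : PerV u) (hdu : DivFree u) (w : ℝ × ℝ → ℝ × ℝ)
    (k n : ℤ × ℤ) :
    ‖pairTerm φ u w (k, n) + pairTerm φ u w (-n, -k)‖ ≤
      C * (majTerm D u w k n + majTerm D u w n k) := by
  set a := fc (comp1 u) (k - n) with ha
  set b := fc (comp2 u) (k - n) with hb
  have e : pairTerm φ u w (k, n) + pairTerm φ u w (-n, -k) =
      (a * ((φ k.2 ^ 2 * n.1 - φ n.2 ^ 2 * k.1 : ℝ) : ℂ) +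
        b * ((φ k.2 ^ 2 * n.2 - φ n.2 ^ 2 * k.2 : ℝ) : ℂ)) *
      (fc (comp1 w) n * (starRingEnd ℂ) (fc (comp1 w) k) +
        fc (comp2 w) n * (starRingEnd ℂ) (fc (comp2 w) k)) := by
    have hkn : -n - -k = k - n := by abel
    simp only [pairTerm, hkn, ← ha, ← hb, fc_neg, Prod.fst_neg, Prod.snd_neg, Int.cast_neg, heven,
      Complex.conj_conj]
    push_cast
    ring
  have hdiv : |((k - n).2 : ℝ)| * ‖b‖ = |((k - n).1 : ℝ)| * ‖a‖ := by
    have h := congrArg norm (eq_neg_of_add_eq_zero_right (hdu.fc_eq hu hpu (k - n)))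
    rw [norm_neg, norm_mul, norm_mul, Complex.norm_intCast, Complex.norm_intCast] at h
    exact h
  have hDk : 0 ≤ D k.2 := hD k.2
  have hDn : 0 ≤ D n.2 := hD n.2
  have hb1 : ‖a * ((φ k.2 ^ 2 * n.1 - φ n.2 ^ 2 * k.1 : ℝ) : ℂ)‖ ≤
      ‖a‖ * (C * D k.2 * |(n.1 : ℝ)| + C * D n.2 * |(k.1 : ℝ)|) := by
    rw [norm_mul, Complex.norm_real, Real.norm_eq_abs]
    gcongr
    refine (abs_sub _ _).trans ?_
    rw [abs_mul, abs_mul, abs_of_nonneg (sq_nonneg (φ k.2)), abs_of_nonneg (sq_nonneg (φ n.2))]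
    gcongr
    · exact h₁ _
    · exact h₁ _
  have hb2 : ‖b * ((φ k.2 ^ 2 * n.2 - φ n.2 ^ 2 * k.2 : ℝ) : ℂ)‖ ≤
      ‖a‖ * (C * |((k - n).1 : ℝ)| * (D k.2 + D n.2)) := by
    rw [norm_mul, Complex.norm_real, Real.norm_eq_abs]
    calc ‖b‖ * |φ k.2 ^ 2 * n.2 - φ n.2 ^ 2 * k.2|
        ≤ ‖b‖ * (C * |((k - n).2 : ℝ)| * (D k.2 + D n.2)) := by
          gcongr
          simpa using h₂ k.2 n.2
      _ = C * (|((k - n).2 : ℝ)| * ‖b‖) * (D k.2 + D n.2) := by ring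
      _ = _ := by rw [hdiv]; ring
  have hau : ‖a‖ ≤ amp u (k - n) := by
    rw [amp]
    exact le_add_of_nonneg_right (norm_nonneg _)
  have hsymm : amp u (n - k) = amp u (k - n) := by rw [← amp_neg, neg_sub]
  have habs : |((n - k).1 : ℝ)| = |((k - n).1 : ℝ)| := by
    simp only [Prod.fst_sub, Int.cast_sub]
    exact abs_sub_comm _ _
  have hwn : 0 ≤ amp w n := amp_nonneg w n
  have hwk : 0 ≤ amp w k := amp_nonneg w k
  rw [e, norm_mul]
  calc _ ≤ (‖a‖ * (C * D k.2 * |(n.1 : ℝ)| + C * D n.2 * |(k.1 : ℝ)|) +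
        ‖a‖ * (C * |((k - n).1 : ℝ)| * (D k.2 + D n.2))) * (amp w n * amp w k) := by
        refine mul_le_mul ((norm_add_le _ _).trans (add_le_add hb1 hb2)) (norm_pair_le w k n)
          (norm_nonneg _) (by positivity)
    _ = ‖a‖ * (C * (D k.2 * (|(n.1 : ℝ)| + |((k - n).1 : ℝ)|) +
        D n.2 * (|(k.1 : ℝ)| + |((k - n).1 : ℝ)|)) * (amp w n * amp w k)) := by ring
    _ ≤ amp u (k - n) * (C * (D k.2 * (|(n.1 : ℝ)| + |((k - n).1 : ℝ)|) +
        D n.2 * (|(k.1 : ℝ)| + |((k - n).1 : ℝ)|)) * (amp w n * amp w k)) := by gcongr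
    _ = _ := by
        rw [majTerm, majTerm, hsymm, habs]
        ring

lemma blockSymb_neg (χ θ : ℝ → ℝ) (j : ℤ) (z : ℝ) :
    blockSymb χ θ j (-z) = blockSymb χ θ j z := by
  simp only [blockSymb, abs_neg]

lemma majTerm_nonneg {D : ℝ → ℝ} (hD : 0 ≤ D) (u w : ℝ × ℝ → ℝ × ℝ) (k n : ℤ × ℤ) :
    0 ≤ majTerm D u w k n := by
  have h1 := hD k.2
  have h2 := amp_nonneg u (k - n)
  have h3 := amp_nonneg w n
  have h4 := amp_nonneg w k
  simp only [Pi.zero_apply] at h1 h2 h3 h4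
  unfold majTerm
  positivity

/-- Bound of a single block pairing. -/
lemma exists_enorm_ipCV_le {χ θ : ℝ → ℝ} (hp : IsDyadicPartition χ θ) :
    ∃ C : ℝ≥0∞, C ≠ ∞ ∧ ∀ j : ℤ, -1 ≤ j → ∀ u w : ℝ × ℝ → ℝ × ℝ,
      SmoothV u → PerV u → DivFree u → SmoothV w → PerV w →
      ‖ipCV (LPV χ θ j (advect u w)) (LPV χ θ j w)‖ₑ ≤
        C * ∑' k, ∑' n, ENNReal.ofReal (majTerm (blockInd χ θ j) u w k n) := by
  obtain ⟨C, hC, h⟩ := exists_symbol_le hp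
  refine ⟨‖((2 * π) ^ 2 * Complex.I : ℂ)‖ₑ * ENNReal.ofReal C * 2,
    by finiteness, fun j hj u w hu hpu hdu hw hpw => ?_⟩
  obtain ⟨h₁, h₂⟩ := h j hj
  have hD : 0 ≤ blockInd χ θ j := fun z => blockInd_nonneg χ θ j z
  have hM : ∀ z, blockSymb χ θ j z ^ 2 ≤ C := fun z => (h₁ z).trans (by
    refine mul_le_of_le_one_right hC ?_
    unfold blockInd
    split_ifs <;> norm_num)
  set f : (ℤ × ℤ) → (ℤ × ℤ) → ℝ≥0∞ :=
    fun k n => ENNReal.ofReal (majTerm (blockInd χ θ j) u w k n) with hf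
  have hle : ‖∑' p, pairTerm (blockSymb χ θ j) u w p‖ₑ ≤
      ENNReal.ofReal C * 2 * ∑' k, ∑' n, f k n := by
    calc ‖∑' p, pairTerm (blockSymb χ θ j) u w p‖ₑ
        ≤ ‖2 * ∑' p, pairTerm (blockSymb χ θ j) u w p‖ₑ := by
          rw [enorm_mul]
          refine le_mul_of_one_le_left zero_le ?_
          simp [enorm_eq_nnnorm]
      _ ≤ ∑' p : (ℤ × ℤ) × (ℤ × ℤ), ENNReal.ofReal C * (f p.1 p.2 + f p.2 p.1) := by
          rw [two_mul_tsum_pairTerm hM hw hpw]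
          refine enorm_tsum_le_tsum_enorm.trans (ENNReal.tsum_le_tsum fun p => ?_)
          rw [hf, ← ENNReal.ofReal_add (majTerm_nonneg hD _ _ _ _) (majTerm_nonneg hD _ _ _ _),
            ← ENNReal.ofReal_mul hC, ← ofReal_norm]
          exact ENNReal.ofReal_le_ofReal (norm_symmetrised_le hC hD (blockSymb_neg χ θ j) h₁ h₂
            hu hpu hdu w p.1 p.2)
      _ = ENNReal.ofReal C * 2 * ∑' k, ∑' n, f k n := by
          rw [ENNReal.tsum_mul_left, ENNReal.tsum_add, ENNReal.tsum_prod (f := fun k n => f k n),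
            ENNReal.tsum_prod (f := fun k n => f n k), ENNReal.tsum_comm (f := fun k n => f n k)]
          ring
  rw [ipCV_eq_tsum hM hu hpu hw hpw, enorm_mul, mul_assoc (‖_‖ₑ) (ENNReal.ofReal C), mul_assoc]
  gcongr

lemma majTerm_eq_mul (D : ℝ → ℝ) (u w : ℝ × ℝ → ℝ × ℝ) (k n : ℤ × ℤ) :
    majTerm D u w k n = D k.2 * majTerm 1 u w k n := by
  simp only [majTerm, Pi.one_apply, one_mul]

/-- Summation of the block majorants over finitely many blocks. -/
lemma exists_sum_majTerm_le {χ θ : ℝ → ℝ} (hp : IsDyadicPartition χ θ) {s : ℝ} (hs : 0 < s) :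
    ∃ C : ℝ≥0∞, C ≠ ∞ ∧ ∀ F : Finset ℤ, (∀ j ∈ F, -1 ≤ j) → ∀ u w : ℝ × ℝ → ℝ × ℝ,
      ∑ j ∈ F, ENNReal.ofReal ((2 : ℝ) ^ (2 * (j : ℝ) * s)) *
          ∑' k, ∑' n, ENNReal.ofReal (majTerm (blockInd χ θ j) u w k n) ≤
        C * ∑' k : ℤ × ℤ, ∑' n, ENNReal.ofReal (jap s k.2 * majTerm 1 u w k n) := by
  obtain ⟨C, hC, h⟩ := exists_sum_blockInd_le hp hs
  refine ⟨ENNReal.ofReal C, ENNReal.ofReal_ne_top, fun F hF u w => ?_⟩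
  simp only [← ENNReal.tsum_mul_left]
  rw [← Summable.tsum_finsetSum fun _ _ => ENNReal.summable]
  refine ENNReal.tsum_le_tsum fun k => ?_
  rw [← Summable.tsum_finsetSum fun _ _ => ENNReal.summable]
  refine ENNReal.tsum_le_tsum fun n => ?_
  have hn : ∀ j ∈ F, 0 ≤ (2 : ℝ) ^ (2 * (j : ℝ) * s) * majTerm (blockInd χ θ j) u w k n :=
    fun j _ => mul_nonneg (by positivity)
      (majTerm_nonneg (fun z => blockInd_nonneg χ θ j z) u w k n)
  have e : ∀ j ∈ F, ENNReal.ofReal ((2 : ℝ) ^ (2 * (j : ℝ) * s)) *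
      ENNReal.ofReal (majTerm (blockInd χ θ j) u w k n) =
      ENNReal.ofReal ((2 : ℝ) ^ (2 * (j : ℝ) * s) * majTerm (blockInd χ θ j) u w k n) :=
    fun j _ => (ENNReal.ofReal_mul (by positivity)).symm
  rw [Finset.sum_congr rfl e, ← ENNReal.ofReal_sum_of_nonneg hn, ← ENNReal.ofReal_mul hC]
  refine ENNReal.ofReal_le_ofReal ?_
  simp only [majTerm_eq_mul (blockInd χ θ _), ← mul_assoc, ← Finset.sum_mul]
  exact mul_le_mul_of_nonneg_right (h F hF k.2) (majTerm_nonneg (fun _ => zero_le_one) u w k n)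

lemma abs_fst_mul_amp {u : ℝ × ℝ → ℝ × ℝ} (hu : SmoothV u) (hp : PerV u) (k : ℤ × ℤ) :
    amp (pd1V u) k = |(k.1 : ℝ)| * amp u k := by
  have h1 := fc_pd1 hu.comp1 hp.1 k
  have h2 := fc_pd1 hu.comp2 hp.2 k
  rw [amp, show comp1 (pd1V u) = pd1 (comp1 u) from rfl,
    show comp2 (pd1V u) = pd1 (comp2 u) from rfl, h1, h2]
  simp only [norm_mul, Complex.norm_I, one_mul, Complex.norm_intCast, amp]
  ring

lemma SmoothV.pd1V {u : ℝ × ℝ → ℝ × ℝ} (hu : SmoothV u) : SmoothV (pd1V u) := by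
  have h : ∀ {f : ℝ × ℝ → ℝ}, Smooth f → Smooth (pd1 f) := fun hf =>
    (hf.fderiv_right (m := (⊤ : ℕ∞)) (by simp)).clm_apply contDiff_const
  exact (h hu.comp1).prodMk (h hu.comp2)

lemma PerV.pd1V {u : ℝ × ℝ → ℝ × ℝ} (hp : PerV u) (hu : SmoothV u) : PerV (pd1V u) := by
  have h : ∀ {f : ℝ × ℝ → ℝ}, Smooth f → Per f → Per (pd1 f) := fun hf hp =>
    have h := smoothPer_fderiv hf hp (1, 0)
    ⟨fun x => Complex.ofReal_injective (h.per₁ x), fun x => Complex.ofReal_injective (h.per₂ x)⟩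
  exact ⟨h hu.comp1 hp.1, h hu.comp2 hp.2⟩

lemma SmoothPer.summable_aw {F : ℝ × ℝ → ℂ} (hF : SmoothPer F) (a b : ℝ) :
    Summable fun k => aw a b k * ‖fcC F k‖ ^ 2 := by
  obtain ⟨p, hpa⟩ := exists_nat_ge (max a b)
  obtain ⟨M, hM⟩ := exists_norm_fcC_le F
  refine Summable.of_nonneg_of_le (fun k => ?_) (fun k => ?_) ((hF.summable p).mul_left M)
  · unfold aw
    positivity
  · have h1 : (1 + (k.1 : ℝ) ^ 2) ^ a ≤ (1 + (k.1 : ℝ) ^ 2) ^ p := by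
      rw [← Real.rpow_natCast _ p]
      exact Real.rpow_le_rpow_of_exponent_le (le_add_of_nonneg_right (sq_nonneg _))
        ((le_max_left a b).trans hpa)
    have h2 : (1 + (k.2 : ℝ) ^ 2) ^ b ≤ (1 + (k.2 : ℝ) ^ 2) ^ p := by
      rw [← Real.rpow_natCast _ p]
      exact Real.rpow_le_rpow_of_exponent_le (le_add_of_nonneg_right (sq_nonneg _))
        ((le_max_right a b).trans hpa)
    calc aw a b k * ‖fcC F k‖ ^ 2
        ≤ (1 + (k.1 : ℝ) ^ 2) ^ p * (1 + (k.2 : ℝ) ^ 2) ^ p * (M * ‖fcC F k‖) := by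
          rw [sq]
          unfold aw
          gcongr
          exact hM k
      _ = _ := by rw [mul_pow]; ring

lemma nrm_amp_le {u : ℝ × ℝ → ℝ × ℝ} (hu : SmoothV u) (hp : PerV u) (a b : ℝ) :
    nrm a b (amp u) ≤ ENNReal.ofReal (√2 * HNV a b u) := by
  have h1 : Summable fun k => aw a b k * ‖fc (comp1 u) k‖ ^ 2 :=
    (smoothPer_ofReal hu.comp1 hp.1).summable_aw a b
  have h2 : Summable fun k => aw a b k * ‖fc (comp2 u) k‖ ^ 2 :=
    (smoothPer_ofReal hu.comp2 hp.2).summable_aw a b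
  have haw : ∀ k, 0 ≤ aw a b k := fun k => by
    unfold aw
    positivity
  refine l2_le_of_sq_le ?_
  have hH : ∀ f, 0 ≤ HSq a b f := fun f =>
    tsum_nonneg fun k => mul_nonneg (haw k) (sq_nonneg _)
  have hR : (√2 * HNV a b u) ^ 2 = ∑' k, 2 * (aw a b k * ‖fc (comp1 u) k‖ ^ 2 +
      aw a b k * ‖fc (comp2 u) k‖ ^ 2) := by
    rw [mul_pow, Real.sq_sqrt zero_le_two, HNV, Real.sq_sqrt (add_nonneg (hH _) (hH _)),
      tsum_mul_left, HSq, HSq, ← h1.tsum_add h2]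
  rw [← ENNReal.ofReal_pow (by unfold HNV; positivity), hR, ENNReal.ofReal_tsum_of_nonneg
    (fun k => by have := haw k; positivity) ((h1.add h2).mul_left 2)]
  refine ENNReal.tsum_le_tsum fun k => ?_
  have hj : ∀ (a : ℝ) n, jap (a / 2) n ^ 2 = jap a n := fun a n => by
    rw [sq, ← jap_add, add_halves]
  have hamp : 0 ≤ amp u k := amp_nonneg u k
  have hj1 := jap_pos (a / 2) k.1
  have hj2 := jap_pos (b / 2) k.2
  rw [← ENNReal.ofReal_pow (by positivity), mul_pow, mul_pow, hj, hj]
  refine ENNReal.ofReal_le_ofReal ?_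
  have e : jap a k.1 * jap b k.2 = aw a b k := rfl
  rw [e, ← mul_add, mul_left_comm]
  refine mul_le_mul_of_nonneg_left ?_ (haw k)
  unfold amp
  nlinarith [sq_nonneg (‖fc (comp1 u) k‖ - ‖fc (comp2 u) k‖)]

lemma ofReal_trilinear_eq (C : ℝ≥0∞) {r w' u' u₀ w₀ dw dw₀ du du₀ : ℝ} (hr : 0 ≤ r)
    (hw : 0 ≤ w') (hu : 0 ≤ u') (hu₀ : 0 ≤ u₀) (hw₀ : 0 ≤ w₀) (hdw : 0 ≤ dw) (hdw₀ : 0 ≤ dw₀)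
    (hdu : 0 ≤ du) (hdu₀ : 0 ≤ du₀) :
    C * ENNReal.ofReal (r * w') *
        (ENNReal.ofReal (r * u') * ENNReal.ofReal (r * dw₀) +
          ENNReal.ofReal (r * u₀) * ENNReal.ofReal (r * dw)) +
      C * ENNReal.ofReal (r * w') *
        (ENNReal.ofReal (r * w') * ENNReal.ofReal (r * du₀) +
          ENNReal.ofReal (r * w₀) * ENNReal.ofReal (r * du)) =
      C * ENNReal.ofReal (r ^ 3) *
        ENNReal.ofReal (w' * (u₀ * dw + u' * dw₀ + du₀ * w' + du * w₀)) := by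
  lift r to ℝ≥0 using hr
  lift w' to ℝ≥0 using hw
  lift u' to ℝ≥0 using hu
  lift u₀ to ℝ≥0 using hu₀
  lift w₀ to ℝ≥0 using hw₀
  lift dw to ℝ≥0 using hdw
  lift dw₀ to ℝ≥0 using hdw₀
  lift du to ℝ≥0 using hdu
  lift du₀ to ℝ≥0 using hdu₀
  simp only [← NNReal.coe_mul, ← NNReal.coe_add, ← NNReal.coe_pow, ENNReal.ofReal_coe_nnreal]
  push_cast
  ring

/-- The summed majorant is controlled by the anisotropic Sobolev norms. -/
lemma exists_majTerm_le {s₀ s : ℝ} (hs₀ : 1 / 2 < s₀) (hs : s₀ ≤ s) :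
    ∃ C : ℝ≥0∞, C ≠ ∞ ∧ ∀ u w : ℝ × ℝ → ℝ × ℝ, SmoothV u → PerV u → SmoothV w → PerV w →
      ∑' k : ℤ × ℤ, ∑' n, ENNReal.ofReal (jap s k.2 * majTerm 1 u w k n) ≤
        C * ENNReal.ofReal (HNV (1/4) s w *
          (HNV (1/4) s₀ u * HNV 0 s (pd1V w) + HNV (1/4) s u * HNV 0 s₀ (pd1V w) +
            HNV 0 s₀ (pd1V u) * HNV (1/4) s w + HNV 0 s (pd1V u) * HNV (1/4) s₀ w)) := by
  obtain ⟨C, hC, h⟩ := exists_trilinear_le hs₀ hs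
  refine ⟨C * ENNReal.ofReal (√2 ^ 3), by finiteness, fun u w hu hpu hw hpw => ?_⟩
  have hH : ∀ a b u, 0 ≤ HNV a b u := fun a b u => Real.sqrt_nonneg _
  have h1 := h (amp u) (amp (pd1V w)) (amp w) (amp_nonneg _) (amp_nonneg _) (amp_nonneg _)
  have h2 := h (amp w) (amp (pd1V u)) (amp w) (amp_nonneg _) (amp_nonneg _) (amp_nonneg _)
  have hsplit : ∀ k : ℤ × ℤ, ∑' n, ENNReal.ofReal (jap s k.2 * majTerm 1 u w k n) =
      ∑' n, ENNReal.ofReal (jap s k.2 * (amp u n * amp (pd1V w) (k - n) * amp w k)) +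
      ∑' n, ENNReal.ofReal (jap s k.2 * (amp w n * amp (pd1V u) (k - n) * amp w k)) := fun k => by
    have hnn : ∀ (x y z : ℝ × ℝ → ℝ × ℝ) (l m n : ℤ × ℤ),
        0 ≤ jap s k.2 * (amp x l * amp y m * amp z n) := fun x y z l m n =>
      mul_nonneg (jap_pos _ _).le (mul_nonneg (mul_nonneg (amp_nonneg _ _) (amp_nonneg _ _))
        (amp_nonneg _ _))
    rw [← (Equiv.subLeft k).tsum_eq fun n =>
      ENNReal.ofReal (jap s k.2 * (amp u n * amp (pd1V w) (k - n) * amp w k)), ← ENNReal.tsum_add]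
    refine tsum_congr fun n => ?_
    rw [← ENNReal.ofReal_add (hnn _ _ _ _ _ _) (hnn _ _ _ _ _ _)]
    congr 1
    simp only [majTerm, Pi.one_apply, one_mul, Equiv.subLeft_apply, sub_sub_cancel,
      abs_fst_mul_amp hu hpu, abs_fst_mul_amp hw hpw]
    ring
  simp only [hsplit]
  rw [ENNReal.tsum_add]
  have hu' := nrm_amp_le hu hpu
  have hw' := nrm_amp_le hw hpw
  have hdu := nrm_amp_le hu.pd1V (hpu.pd1V hu)
  have hdw := nrm_amp_le hw.pd1V (hpw.pd1V hw)
  refine (add_le_add h1 h2).trans ?_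
  calc _ ≤ C * ENNReal.ofReal (√2 * HNV (1/4) s w) *
          (ENNReal.ofReal (√2 * HNV (1/4) s u) * ENNReal.ofReal (√2 * HNV 0 s₀ (pd1V w)) +
            ENNReal.ofReal (√2 * HNV (1/4) s₀ u) * ENNReal.ofReal (√2 * HNV 0 s (pd1V w))) +
        C * ENNReal.ofReal (√2 * HNV (1/4) s w) *
          (ENNReal.ofReal (√2 * HNV (1/4) s w) * ENNReal.ofReal (√2 * HNV 0 s₀ (pd1V u)) +
            ENNReal.ofReal (√2 * HNV (1/4) s₀ w) * ENNReal.ofReal (√2 * HNV 0 s (pd1V u))) := by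
        exact add_le_add
          (mul_le_mul' (mul_le_mul' le_rfl (hw' _ _))
            (add_le_add (mul_le_mul' (hu' _ _) (hdw _ _)) (mul_le_mul' (hu' _ _) (hdw _ _))))
          (mul_le_mul' (mul_le_mul' le_rfl (hw' _ _))
            (add_le_add (mul_le_mul' (hw' _ _) (hdu _ _)) (mul_le_mul' (hw' _ _) (hdu _ _))))
    _ = _ := ofReal_trilinear_eq C (Real.sqrt_nonneg 2) (hH _ _ _) (hH _ _ _) (hH _ _ _)
        (hH _ _ _) (hH _ _ _) (hH _ _ _) (hH _ _ _) (hH _ _ _)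

/-- Chemin–Desjardins–Gallagher–Grenier-type commutator estimate:
for `s₀ > 1/2`, `s ≥ s₀`, there is `C > 0` such that for all smooth divergence-free
vector fields `u, w`,
`Σ_{k≥−1} 2^{2ks} |⟨Δ^v_k(u·∇w), Δ^v_k w⟩| ≤ C ‖w‖_{H^{1/4,s}} ( ... )`. -/
theorem LP_nonlinear_estimate (χ θ : ℝ → ℝ) (hp : IsDyadicPartition χ θ)
    (s₀ s : ℝ) (hs₀ : 1/2 < s₀) (hs : s₀ ≤ s) :
    ∃ C > 0, ∀ u w : ℝ × ℝ → ℝ × ℝ,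
      SmoothV u → PerV u → DivFree u →
      SmoothV w → PerV w → DivFree w →
      (∑' k : {j : ℤ // -1 ≤ j}, (2 : ℝ) ^ (2 * (k.1 : ℝ) * s) *
          ‖ipCV (LPV χ θ k.1 (advect u w)) (LPV χ θ k.1 w)‖) ≤
        C * HNV (1/4) s w *
          (HNV (1/4) s₀ u * HNV 0 s (pd1V w) + HNV (1/4) s u * HNV 0 s₀ (pd1V w) +
            HNV 0 s₀ (pd1V u) * HNV (1/4) s w + HNV 0 s (pd1V u) * HNV (1/4) s₀ w) := by
  obtain ⟨C₁, hC₁, h₁⟩ := exists_enorm_ipCV_le hp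
  obtain ⟨C₂, hC₂, h₂⟩ := exists_sum_majTerm_le hp (s := s) (by linarith)
  obtain ⟨C₃, hC₃, h₃⟩ := exists_majTerm_le hs₀ hs
  refine ⟨(C₁ * (C₂ * C₃)).toReal + 1, by positivity, fun u w hu hpu hdu hw hpw _ => ?_⟩
  have hH : ∀ a b u, 0 ≤ HNV a b u := fun a b u => Real.sqrt_nonneg _
  rw [mul_assoc]
  set R := HNV (1/4) s w *
    (HNV (1/4) s₀ u * HNV 0 s (pd1V w) + HNV (1/4) s u * HNV 0 s₀ (pd1V w) +
      HNV 0 s₀ (pd1V u) * HNV (1/4) s w + HNV 0 s (pd1V u) * HNV (1/4) s₀ w) with hR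
  have hR0 : 0 ≤ R := mul_nonneg (hH _ _ _) (add_nonneg (add_nonneg (add_nonneg
    (mul_nonneg (hH _ _ _) (hH _ _ _)) (mul_nonneg (hH _ _ _) (hH _ _ _)))
    (mul_nonneg (hH _ _ _) (hH _ _ _))) (mul_nonneg (hH _ _ _) (hH _ _ _)))
  have hCtop : C₁ * (C₂ * C₃) ≠ ∞ := by finiteness
  refine Real.tsum_le_of_sum_le (fun k => by positivity) fun G => ?_
  have key : ENNReal.ofReal (∑ k ∈ G, (2 : ℝ) ^ (2 * (k.1 : ℝ) * s) *
      ‖ipCV (LPV χ θ k.1 (advect u w)) (LPV χ θ k.1 w)‖) ≤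
      ENNReal.ofReal ((C₁ * (C₂ * C₃)).toReal * R) := by
    rw [ENNReal.ofReal_sum_of_nonneg fun k _ => by positivity,
      ENNReal.ofReal_mul ENNReal.toReal_nonneg, ENNReal.ofReal_toReal hCtop]
    have hF := h₂ (G.map (Function.Embedding.subtype _)) (fun j hj => by
      obtain ⟨k, -, rfl⟩ := Finset.mem_map.1 hj
      exact k.2) u w
    rw [Finset.sum_map] at hF
    calc _ ≤ ∑ k ∈ G, C₁ * (ENNReal.ofReal ((2 : ℝ) ^ (2 * (k.1 : ℝ) * s)) *
          ∑' l, ∑' n, ENNReal.ofReal (majTerm (blockInd χ θ k.1) u w l n)) := by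
          refine Finset.sum_le_sum fun k _ => ?_
          rw [ENNReal.ofReal_mul (by positivity), ofReal_norm, mul_left_comm]
          exact mul_le_mul_right (h₁ k.1 k.2 u w hu hpu hdu hw hpw) _
      _ ≤ C₁ * (C₂ * (C₃ * ENNReal.ofReal R)) := by
          rw [← Finset.mul_sum]
          gcongr
          exact hF.trans (mul_le_mul_right (h₃ u w hu hpu hw hpw) _)
      _ = _ := by ring
  refine ((ENNReal.ofReal_le_ofReal_iff (by positivity)).1 key).trans ?_
  gcongr
  linarith

end Aniso
end
end

section
/- There is a constant C > 0 such that for every smooth function u : 𝕋² → ℝ, ‖u‖²_{L²_h(L^∞_v)} ≤ C ( ‖u‖_{L²} ‖∂₂u‖_{L²} + ‖u‖²_{L²} ). -/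
open MeasureTheory Real Complex Filter Set

noncomputable section

namespace Aniso

/-- Cauchy–Schwarz inequality for real square-integrable functions. -/
theorem integral_abs_mul_le_sqrt_mul_sqrt {α : Type*} [MeasurableSpace α] {μ : Measure α}
    {f g : α → ℝ} (hf : MemLp f 2 μ) (hg : MemLp g 2 μ) :
    ∫ a, |f a * g a| ∂μ ≤ √(∫ a, f a ^ 2 ∂μ) * √(∫ a, g a ^ 2 ∂μ) := by
  have h := integral_mul_norm_le_Lp_mul_Lq (μ := μ) (f := f) (g := g)
    Real.HolderConjugate.two_two (by simpa using hf) (by simpa using hg)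
  simpa [Real.sqrt_eq_rpow, abs_mul] using h

/-- One-dimensional Agmon-type inequality on an interval. -/
theorem sq_le_setIntegral_of_hasDerivAt {f f' : ℝ → ℝ} {a b x : ℝ} (hab : a < b)
    (hf : ∀ y, HasDerivAt f (f' y) y) (hf' : Continuous f') (hx : x ∈ Ioc a b) :
    f x ^ 2 ≤ ∫ y in Ioc a b, ((b - a)⁻¹ * f y ^ 2 + 2 * |f y * f' y|) := by
  have hfc : Continuous f := continuous_iff_continuousAt.2 fun y => (hf y).continuousAt
  have hint : ∀ {g : ℝ → ℝ}, Continuous g → IntegrableOn g (Ioc a b) := fun hg =>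
    hg.integrableOn_Icc.mono_set Ioc_subset_Icc_self
  set K := ∫ y in Ioc a b, 2 * |f y * f' y| with hK
  have hpt : ∀ y ∈ Ioc a b, f x ^ 2 - K ≤ f y ^ 2 := by
    intro y hy
    have hftc : ∫ t in y..x, 2 * (f t * f' t) = f x ^ 2 - f y ^ 2 :=
      intervalIntegral.integral_eq_sub_of_hasDerivAt (f := fun t => f t ^ 2)
        (fun t _ => by
          have h := (hf t).pow 2
          exact h.congr_deriv (by push_cast; ring))
        ((by fun_prop : Continuous fun t => 2 * (f t * f' t)).intervalIntegrable _ _)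
    have hle : f x ^ 2 - f y ^ 2 ≤ K := by
      rw [← hftc]
      refine (le_abs_self _).trans ?_
      rw [← Real.norm_eq_abs]
      refine intervalIntegral.norm_integral_le_integral_norm_uIoc.trans ?_
      simp only [norm_mul, Real.norm_eq_abs, abs_two, ← abs_mul, hK]
      refine setIntegral_mono_set (hint (by fun_prop)) (ae_of_all _ fun t => by positivity) ?_
      refine LE.le.eventuallyLE ?_
      exact Ioc_subset_Ioc (le_min hy.1.le hx.1.le) (max_le hy.2 hx.2)
    linarith
  have hav : (b - a) * (f x ^ 2 - K) ≤ ∫ y in Ioc a b, f y ^ 2 := by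
    have h := setIntegral_mono_on (integrableOn_const (by simp)) (hint (hfc.pow 2))
      measurableSet_Ioc hpt
    simpa [hab.le] using h
  rw [integral_add (hint (by fun_prop)) (hint (by fun_prop)), integral_const_mul, ← hK,
    ← sub_le_iff_le_add, inv_mul_eq_div, le_div_iff₀ (sub_pos.2 hab)]
  linarith

/-- The square of the essential supremum of `|f|` is controlled by any a.e. bound of `f ^ 2`. -/
theorem sq_essSup_abs_le {α : Type*} [MeasurableSpace α] {μ : Measure α} [NeZero μ]
    {f : α → ℝ} {B : ℝ} (h : ∀ᵐ y ∂μ, f y ^ 2 ≤ B) :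
    essSup (fun y => |f y|) μ ^ 2 ≤ B := by
  have hle : ∀ᵐ y ∂μ, |f y| ≤ √B := h.mono fun y hy => Real.abs_le_sqrt hy
  have hB : 0 ≤ B := by
    obtain ⟨y, hy⟩ := h.exists
    exact (sq_nonneg _).trans hy
  have h1 : essSup (fun y => |f y|) μ ≤ √B :=
    limsup_le_of_le (IsCoboundedUnder.of_frequently_ge (a := 0)
      (Eventually.of_forall fun y => abs_nonneg (f y)).frequently) hle
  have h0 : 0 ≤ essSup (fun y => |f y|) μ :=
    le_limsup_of_le ⟨√B, hle⟩ fun b hb => by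
      obtain ⟨y, hy⟩ := hb.exists
      exact (abs_nonneg _).trans hy
  exact (pow_le_pow_left₀ h0 h1 2).trans (Real.sq_sqrt hB).le

theorem Q2_subset_Icc : Q2 ⊆ Icc ((0 : ℝ), (0 : ℝ)) (2 * π, 2 * π) := by
  rw [← Icc_prod_Icc]
  exact prod_mono Ioc_subset_Icc_self Ioc_subset_Icc_self

theorem integrableOn_Q2_s5 {f : ℝ × ℝ → ℝ} (hf : Continuous f) : IntegrableOn f Q2 :=
  (hf.continuousOn.integrableOn_compact isCompact_Icc).mono_set Q2_subset_Icc

theorem memLp_two_Q2 {f : ℝ × ℝ → ℝ} (hf : Continuous f) : MemLp f 2 (volume.restrict Q2) :=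
  (memLp_two_iff_integrable_sq hf.aestronglyMeasurable).2 (integrableOn_Q2_s5 (hf.pow 2))

theorem hasDerivAt_pd2 {u : ℝ × ℝ → ℝ} (hu : Smooth u) (x y : ℝ) :
    HasDerivAt (fun t => u (x, t)) (pd2 u (x, y)) y :=
  ((hu.differentiable (by simp)) (x, y)).hasFDerivAt.comp_hasDerivAt y
    ((hasDerivAt_const y x).prodMk (hasDerivAt_id y))

theorem continuous_pd2 {u : ℝ × ℝ → ℝ} (hu : Smooth u) : Continuous (pd2 u) :=
  (hu.continuous_fderiv (by simp)).clm_apply continuous_const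

theorem sq_L2 (f : ℝ × ℝ → ℝ) : L2 f ^ 2 = ∫ x in Q2, f x ^ 2 :=
  Real.sq_sqrt (integral_nonneg fun _ => sq_nonneg _)

/-- There is `C > 0` such that for every smooth `u : 𝕋² → ℝ`,
`‖u‖²_{L²_h(L^∞_v)} ≤ C (‖u‖_{L²} ‖∂₂u‖_{L²} + ‖u‖²_{L²})`. -/
theorem L2hLinfv_estimate :
    ∃ C > 0, ∀ u : ℝ × ℝ → ℝ, Smooth u → Per u →
      L2hLinfv u ^ 2 ≤ C * (L2 u * L2 (pd2 u) + L2 u ^ 2) := by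
  refine ⟨2, two_pos, fun u hu _ => ?_⟩
  have hpos : (0 : ℝ) < 2 * π := Real.two_pi_pos
  have huc : Continuous u := hu.continuous
  have hdc : Continuous (pd2 u) := continuous_pd2 hu
  set H : ℝ × ℝ → ℝ := fun z => (2 * π)⁻¹ * u z ^ 2 + 2 * |u z * pd2 u z| with hH
  have hHint : IntegrableOn H Q2 := integrableOn_Q2_s5 (by fun_prop)
  have : NeZero (volume.restrict I2pi : Measure ℝ) := ⟨by
    simp [I2pi, Measure.restrict_eq_zero, Real.pi_pos]⟩
  have hslice : ∀ x₁, essSup (fun x₂ : ℝ => |u (x₁, x₂)|) (volume.restrict I2pi) ^ 2 ≤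
      ∫ x₂ in I2pi, H (x₁, x₂) := fun x₁ => sq_essSup_abs_le <| by
    filter_upwards [ae_restrict_mem measurableSet_Ioc] with x₂ hx₂
    have h := sq_le_setIntegral_of_hasDerivAt hpos (hasDerivAt_pd2 hu x₁) (by fun_prop) hx₂
    rwa [sub_zero] at h
  have hHint' : Integrable H ((volume.restrict I2pi).prod (volume.restrict I2pi)) := by
    rwa [Measure.prod_restrict]
  have hmain : L2hLinfv u ^ 2 ≤ ∫ z in Q2, H z := by
    rw [L2hLinfv, Real.sq_sqrt (integral_nonneg fun _ => sq_nonneg _)]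
    calc _ ≤ ∫ x₁ in I2pi, ∫ x₂ in I2pi, H (x₁, x₂) :=
          integral_mono_of_nonneg (ae_of_all _ fun _ => sq_nonneg _)
            hHint'.integral_prod_left (ae_of_all _ hslice)
      _ = ∫ z in Q2, H z := (setIntegral_prod H hHint).symm
  have hsplit : ∫ z in Q2, H z =
      (2 * π)⁻¹ * L2 u ^ 2 + 2 * ∫ z in Q2, |u z * pd2 u z| := by
    rw [sq_L2, hH, integral_add (integrableOn_Q2_s5 (by fun_prop)) (integrableOn_Q2_s5 (by fun_prop)),
      integral_const_mul, integral_const_mul]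
  have hcs : ∫ z in Q2, |u z * pd2 u z| ≤ L2 u * L2 (pd2 u) :=
    integral_abs_mul_le_sqrt_mul_sqrt (memLp_two_Q2 huc) (memLp_two_Q2 hdc)
  have hinv : (2 * π)⁻¹ ≤ 2 :=
    (inv_le_one_of_one_le₀ (by linarith [Real.pi_gt_three])).trans one_le_two
  have hlow := mul_le_mul_of_nonneg_right hinv (sq_nonneg (L2 u))
  linarith

end Aniso
end
end
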